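/- Assume in addition that X is spectrally negative: almost surely, for every t > 0 the jump X(t) − X(t−) is nonpositive (X has no positive jumps), and X does not have nonincreasing sample paths. Let ψ(θ) := log E[e^{θ Y(1)}], which is finite for all θ ≥ 0, let Φ(q) := sup{θ ≥ 0 : ψ(θ) = q} be its right inverse, and note Φ(0) > 0. Let e_q be an exponentially distributed random variable with parameter q > 0, independent of X and of Q_e. Then for all x > 0 and q > 0: E[exp(−x · max(0, Q_e + Y̲(e_q)))] = (Φ(0)/(x + Φ(0))) · ((Φ(q) + x)/Φ(q)). -/

import Mathlib

open MeasureTheory ProbabilityTheory Filter Set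

set_option linter.unusedSectionVars false
open scoped Topology

def Cad (f : ℝ → ℝ) : Prop := ∀ t, 0 ≤ t → ContinuousWithinAt f (Set.Ici t) t ∧
  (0 < t → ∃ l : ℝ, Tendsto f (nhdsWithin t (Set.Iio t)) (nhds l))

lemma Cad.neg {f : ℝ → ℝ} (h : Cad f) : Cad (fun t => - f t) := by
  intro t ht
  obtain ⟨h1, h2⟩ := h t ht
  refine ⟨h1.neg, fun h0 => ?_⟩
  obtain ⟨l, hl⟩ := h2 h0
  exact ⟨-l, hl.neg⟩

lemma Cad.bdd {f : ℝ → ℝ} (h : Cad f) (T : ℝ) : ∃ C, ∀ s ∈ Icc 0 T, |f s| ≤ C := by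
  have key : ∃ C, ∀ s ∈ Icc 0 T, 0 ≤ s → |f s| ≤ C := by
    refine isCompact_Icc.induction_on (p := fun S => ∃ C, ∀ s ∈ S, 0 ≤ s → |f s| ≤ C) ?_ ?_ ?_ ?_
    · exact ⟨0, by simp⟩
    · rintro s t hst ⟨C, hC⟩
      exact ⟨C, fun u hu => hC u (hst hu)⟩
    · rintro s t ⟨C, hC⟩ ⟨D, hD⟩
      refine ⟨max C D, ?_⟩
      rintro u (hu | hu) h0
      · exact (hC u hu h0).trans (le_max_left _ _)
      · exact (hD u hu h0).trans (le_max_right _ _)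
    · intro t ht
      obtain ⟨h1, h2⟩ := h t ht.1
      have e1 : ∀ᶠ s in 𝓝[≥] t, |f s| < |f t| + 1 := h1.abs.eventually_lt_const (by linarith)
      have e2 : ∃ D, ∀ᶠ s in 𝓝[<] t, 0 ≤ s → |f s| ≤ D := by
        rcases ht.1.eq_or_lt with h0 | h0
        · refine ⟨0, ?_⟩
          filter_upwards [self_mem_nhdsWithin] with s hs h0'
          simp only [mem_Iio] at hs
          linarith
        · obtain ⟨l, hl⟩ := h2 h0
          refine ⟨|l| + 1, ?_⟩
          filter_upwards [hl.abs.eventually_lt_const (show |l| < |l| + 1 by linarith)] with s hs _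
          exact hs.le
      obtain ⟨D, e2⟩ := e2
      have e3 : ∀ᶠ s in 𝓝 t, 0 ≤ s → |f s| ≤ max D (|f t| + 1) := by
        rw [← nhdsLT_sup_nhdsGE, eventually_sup]
        constructor
        · filter_upwards [e2] with s hs h0
          exact (hs h0).trans (le_max_left _ _)
        · filter_upwards [e1] with s hs h0
          exact hs.le.trans (le_max_right _ _)
      exact ⟨_, mem_nhdsWithin_of_mem_nhds e3, _, fun s hs => hs⟩
  obtain ⟨C, hC⟩ := key
  exact ⟨C, fun s hs => hC s hs hs.1⟩

noncomputable def UU (t : ℝ) (f : ℝ → ℝ) : ℝ :=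
  ⨅ n : ℕ, ⨆ r : ℚ, if 0 ≤ (r : ℝ) ∧ (r : ℝ) < t + 1 / ((n : ℝ) + 1) then f r else f 0

lemma Cad.ex_right {f : ℝ → ℝ} (h : Cad f) {s : ℝ} (hs : 0 ≤ s) {b : ℝ} (hb : b < f s) :
    ∃ δ > 0, ∀ u, s ≤ u → u < s + δ → b < f u := by
  have := ((h s hs).1.eventually_const_lt hb)
  rw [eventually_nhdsWithin_iff, Metric.eventually_nhds_iff] at this
  obtain ⟨δ, h0, hd⟩ := this
  refine ⟨δ, h0, fun u h1 h2 => hd ?_ h1⟩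
  rw [Real.dist_eq, abs_lt]; constructor <;> linarith

lemma Cad.isLUB {f : ℝ → ℝ} (h : Cad f) {t : ℝ} (ht : 0 ≤ t) : IsLUB (f '' Icc 0 t) (UU t f) := by
  obtain ⟨C, hC⟩ := h.bdd (t + 1)
  have hn : ∀ n : ℕ, (0 : ℝ) < 1 / ((n : ℝ) + 1) ∧ 1 / ((n : ℝ) + 1) ≤ 1 := fun n => by
    refine ⟨by positivity, ?_⟩
    rw [div_le_one (by positivity)]; linarith [Nat.cast_nonneg (α := ℝ) n]
  have hb : ∀ n : ℕ, BddAbove (range fun r : ℚ => if 0 ≤ (r : ℝ) ∧ (r : ℝ) < t + 1 / ((n : ℝ) + 1) then f r else f 0) := by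
    intro n
    refine ⟨C, ?_⟩
    rintro _ ⟨r, rfl⟩
    simp only
    split_ifs with hr
    · exact (le_abs_self _).trans (hC _ ⟨hr.1, by linarith [(hn n).2]⟩)
    · exact (le_abs_self _).trans (hC _ ⟨le_rfl, by linarith⟩)
  have hge : ∀ n : ℕ, ∀ s ∈ Icc 0 t, f s ≤ ⨆ r : ℚ, if 0 ≤ (r : ℝ) ∧ (r : ℝ) < t + 1 / ((n : ℝ) + 1) then f r else f 0 := by
    intro n s hs
    refine le_of_forall_lt fun b hbf => ?_
    obtain ⟨δ, h0, hδ⟩ := h.ex_right hs.1 hbf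
    obtain ⟨r, hr1, hr2⟩ := exists_rat_btwn (show s < min (s + δ) (t + 1 / ((n : ℝ) + 1)) from
      lt_min (by linarith) (by linarith [(hn n).1, hs.2]))
    refine lt_of_lt_of_le ?_ (le_ciSup (hb n) r)
    rw [if_pos ⟨hs.1.trans hr1.le, hr2.trans_le (min_le_right _ _)⟩]
    exact hδ _ hr1.le (hr2.trans_le (min_le_left _ _))
  constructor
  · rintro _ ⟨s, hs, rfl⟩
    exact le_ciInf fun n => hge n s hs
  · intro b hbb
    refine le_of_forall_pos_le_add fun ε hε => ?_
    have hft : -(b + ε) < - f t := by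
      have := hbb ⟨t, ⟨ht, le_rfl⟩, rfl⟩
      linarith
    obtain ⟨δ, h0, hδ⟩ := h.neg.ex_right ht hft
    obtain ⟨n, hnδ⟩ := exists_nat_one_div_lt h0
    refine (ciInf_le ⟨f 0, ?_⟩ n).trans ?_
    · rintro _ ⟨m, rfl⟩
      exact hge m 0 ⟨le_rfl, ht⟩
    · refine ciSup_le fun r => ?_
      split_ifs with hr
      · by_cases hrt : (r : ℝ) ≤ t
        · have := hbb ⟨r, ⟨hr.1, hrt⟩, rfl⟩
          linarith
        · have := hδ r (by linarith) (by linarith)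
          linarith
      · have := hbb ⟨0, ⟨le_rfl, ht⟩, rfl⟩
        linarith

lemma Cad.grid_ex {f : ℝ → ℝ} (h : Cad f) {T s b δ : ℝ} (hT : 0 < T) (hs : s ∈ Icc 0 T)
    (hb : b < f s) (hδ : 0 < δ) :
    ∀ᶠ n : ℕ in atTop, ∃ k : ℕ, k ≤ n + 1 ∧ s ≤ k * (T / ((n : ℝ) + 1)) ∧
      k * (T / ((n : ℝ) + 1)) < s + δ ∧ b < f (k * (T / ((n : ℝ) + 1))) := by
  obtain ⟨ε, h0, hε⟩ := h.ex_right hs.1 hb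
  have e : ∀ᶠ n : ℕ in atTop, T * (1 / ((n : ℝ) + 1)) < min δ ε := by
    have := (tendsto_one_div_add_atTop_nhds_zero_nat (𝕜 := ℝ)).const_mul T
    rw [mul_zero] at this
    exact this.eventually_lt_const (lt_min hδ h0)
  filter_upwards [e] with n hn
  have hn1 : (0 : ℝ) < (n : ℝ) + 1 := by positivity
  have hh : 0 < T / ((n : ℝ) + 1) := by positivity
  have hn' : T / ((n : ℝ) + 1) < min δ ε := by rw [div_eq_mul_one_div]; exact hn
  have h1 := Nat.le_ceil (s / (T / ((n : ℝ) + 1)))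
  have h2 := Nat.ceil_lt_add_one (show 0 ≤ s / (T / ((n : ℝ) + 1)) from div_nonneg hs.1 hh.le)
  have h1' : s ≤ (⌈s / (T / ((n : ℝ) + 1))⌉₊ : ℝ) * (T / ((n : ℝ) + 1)) := by
    rwa [div_le_iff₀ hh] at h1
  have h2' : (⌈s / (T / ((n : ℝ) + 1))⌉₊ : ℝ) * (T / ((n : ℝ) + 1)) < s + T / ((n : ℝ) + 1) := by
    have := mul_lt_mul_of_pos_right h2 hh
    rw [add_mul, div_mul_cancel₀ _ hh.ne'] at this
    linarith
  refine ⟨⌈s / (T / ((n : ℝ) + 1))⌉₊, ?_, h1', ?_, ?_⟩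
  · rw [Nat.ceil_le]
    rw [div_le_iff₀ hh]
    push_cast
    rw [mul_div_cancel₀ _ hn1.ne']
    exact hs.2
  · linarith [min_le_left δ ε]
  · exact hε _ h1' (by linarith [min_le_right δ ε])

lemma grid_mem {T : ℝ} (hT : 0 < T) {n k : ℕ} (hk : k ≤ n + 1) :
    (k * (T / ((n : ℝ) + 1)) : ℝ) ∈ Icc 0 T := by
  have hn1 : (0 : ℝ) < (n : ℝ) + 1 := by positivity
  refine ⟨by positivity, ?_⟩
  have : (k : ℝ) ≤ (n : ℝ) + 1 := by exact_mod_cast hk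
  calc (k * (T / ((n : ℝ) + 1)) : ℝ) ≤ ((n : ℝ) + 1) * (T / ((n : ℝ) + 1)) := by gcongr
    _ = T := mul_div_cancel₀ _ hn1.ne'

noncomputable def gsup (N : ℕ) (v : ℕ → ℝ) : ℝ := (Finset.range (N + 1)).sup' Finset.nonempty_range_add_one v

lemma Cad.grid_sup {f : ℝ → ℝ} (h : Cad f) {T : ℝ} (hT : 0 < T) :
    Tendsto (fun n : ℕ => gsup (n + 1) (fun k => f (k * (T / ((n : ℝ) + 1))))) atTop (𝓝 (UU T f)) := by
  have hl := h.isLUB hT.le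
  rw [tendsto_order]
  constructor
  · intro b hb
    obtain ⟨_, ⟨s, hs, rfl⟩, hbs⟩ := (lt_isLUB_iff hl).1 hb
    filter_upwards [h.grid_ex hT hs hbs one_pos] with n ⟨k, hk, _, _, hbk⟩
    refine lt_of_lt_of_le hbk ?_
    exact Finset.le_sup' (fun k : ℕ => f (k * (T / ((n : ℝ) + 1)))) (Finset.mem_range.2 (by omega))
  · intro b hb
    refine Eventually.of_forall fun n => lt_of_le_of_lt ?_ hb
    refine Finset.sup'_le _ _ fun k hk => hl.1 ⟨_, grid_mem hT ?_, rfl⟩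
    have := Finset.mem_range.1 hk
    omega

def Good (f : ℝ → ℝ) : Prop := Cad f ∧ f 0 = 0 ∧
  ∀ t : ℝ, 0 < t → ∀ l : ℝ, Tendsto f (nhdsWithin t (Set.Iio t)) (nhds l) → f t ≤ l

noncomputable def tau (a : ℝ) (f : ℝ → ℝ) : ℝ := sInf {s | 0 ≤ s ∧ a < f s}

lemma tau_le {a : ℝ} {f : ℝ → ℝ} {s : ℝ} (hs : 0 ≤ s) (h : a < f s) : tau a f ≤ s :=
  csInf_le ⟨0, fun _ h => h.1⟩ ⟨hs, h⟩

lemma Good.f_tau {a : ℝ} {f : ℝ → ℝ} (h : Good f) (ha : 0 < a) (hA : ∃ s, 0 ≤ s ∧ a < f s) :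
    0 < tau a f ∧ f (tau a f) = a := by
  obtain ⟨hc, h0, hj⟩ := h
  have hne : {s | 0 ≤ s ∧ a < f s}.Nonempty := hA
  have hnn : 0 ≤ tau a f := le_csInf hne fun _ h => h.1
  have hge : a ≤ f (tau a f) := by
    by_contra hlt
    push Not at hlt
    obtain ⟨δ, hδ, H⟩ := hc.neg.ex_right hnn (neg_lt_neg hlt)
    obtain ⟨s, hs, hsd⟩ := exists_lt_of_csInf_lt hne (show sInf {s | 0 ≤ s ∧ a < f s} < tau a f + δ by
      change tau a f < _; linarith)
    have := H s (tau_le hs.1 hs.2) hsd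
    linarith [hs.2]
  have hpos : 0 < tau a f := by
    rcases hnn.eq_or_lt with h | h
    · rw [← h, h0] at hge; linarith
    · exact h
  refine ⟨hpos, le_antisymm ?_ hge⟩
  obtain ⟨l, hl⟩ := (hc _ hnn).2 hpos
  refine (hj _ hpos l hl).trans (le_of_tendsto hl ?_)
  filter_upwards [Ioo_mem_nhdsLT hpos] with s hs
  by_contra hlt
  push Not at hlt
  exact absurd (tau_le hs.1.le hlt) (not_le.2 hs.2)

/-- discrete first passage event -/
def FP (a : ℝ) (v : ℕ → ℝ) (k : ℕ) : Prop := a < v k ∧ ∀ j < k, v j ≤ a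

open Classical in
lemma FP_sum {a : ℝ} {v w : ℕ → ℝ} {N k : ℕ} (hk : k ≤ N) (h : FP a v k) :
    ∑ j ∈ Finset.range (N + 1), (if FP a v j then w j else 0) = w k := by
  rw [Finset.sum_eq_single k]
  · rw [if_pos h]
  · intro j _ hj
    rw [if_neg]
    intro h'
    rcases lt_or_gt_of_ne hj with hlt | hlt
    · exact absurd (h.2 j hlt) (not_le.2 h'.1)
    · exact absurd (h'.2 k hlt) (not_le.2 h.1)
  · intro hk'
    exact absurd (Finset.mem_range.2 (by omega)) hk'

lemma FP_ex {a : ℝ} {v : ℕ → ℝ} {k : ℕ} (h : a < v k) : ∃ j ≤ k, FP a v j := by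
  classical
  have hex : ∃ k, a < v k := ⟨k, h⟩
  refine ⟨Nat.find hex, Nat.find_min' hex h, Nat.find_spec hex, fun j hj => ?_⟩
  exact not_lt.1 (Nat.find_min hex hj)

open Classical in
lemma Good.grid_fp {f : ℝ → ℝ} (h : Good f) {T a : ℝ} (hT : 0 < T) (ha : 0 < a) {g : ℝ × ℝ → ℝ}
    (hg : Continuous g) :
    Tendsto (fun n : ℕ => ∑ k ∈ Finset.range (n + 1 + 1),
      if FP a (fun k => f (k * (T / ((n : ℝ) + 1)))) k then g (k * (T / ((n : ℝ) + 1)), f (k * (T / ((n : ℝ) + 1)))) else 0)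
      atTop (𝓝 (if ∃ s ∈ Icc 0 T, a < f s then g (tau a f, a) else 0)) := by
  by_cases hA : ∃ s ∈ Icc 0 T, a < f s
  swap
  · rw [if_neg hA]
    refine tendsto_const_nhds.congr fun n => ?_
    symm
    refine Finset.sum_eq_zero fun k hk => ?_
    rw [if_neg]
    intro hfp
    exact hA ⟨_, grid_mem hT (by have := Finset.mem_range.1 hk; omega), hfp.1⟩
  rw [if_pos hA]
  obtain ⟨s, hs, has⟩ := hA
  obtain ⟨hpos, hfa⟩ := h.f_tau ha ⟨s, hs.1, has⟩
  have key : ∀ δ > 0, ∀ᶠ n : ℕ in atTop, ∃ k ≤ n + 1, FP a (fun k => f (k * (T / ((n : ℝ) + 1)))) k ∧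
      k * (T / ((n : ℝ) + 1)) < tau a f + δ := by
    intro δ hδ
    obtain ⟨u, hu, hud⟩ := exists_lt_of_csInf_lt (show {s | 0 ≤ s ∧ a < f s}.Nonempty from ⟨s, hs.1, has⟩)
      (show sInf {s | 0 ≤ s ∧ a < f s} < tau a f + δ / 2 by change tau a f < _; linarith)
    have hu' : ∃ u, u ∈ Icc 0 T ∧ a < f u ∧ u < tau a f + δ / 2 := by
      by_cases huT : u ≤ T
      · exact ⟨u, ⟨hu.1, huT⟩, hu.2, hud⟩
      · exact ⟨s, hs, has, by linarith [hs.2]⟩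
    obtain ⟨u, huT, hau, hud⟩ := hu'
    filter_upwards [h.1.grid_ex hT huT hau (half_pos hδ)] with n ⟨k, hk, _, hkd, hak⟩
    obtain ⟨j, hj, hfp⟩ := FP_ex (v := fun k => f (k * (T / ((n : ℝ) + 1)))) hak
    refine ⟨j, hj.trans hk, hfp, ?_⟩
    have : (j : ℝ) * (T / ((n : ℝ) + 1)) ≤ k * (T / ((n : ℝ) + 1)) := by
      have : (j : ℝ) ≤ k := by exact_mod_cast hj
      gcongr
    linarith
  have hcont : ContinuousWithinAt (fun s => g (s, f s)) (Ici (tau a f)) (tau a f) :=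
    hg.continuousAt.comp_continuousWithinAt (continuousWithinAt_id.prodMk ((h.1 _ hpos.le).1))
  have e := hcont
  rw [ContinuousWithinAt, hfa] at e
  rw [tendsto_def]
  intro S hS
  have := e hS
  rw [mem_map, mem_nhdsWithin, ] at this
  obtain ⟨O, hO, htO, hsub⟩ := this
  obtain ⟨δ, hδ, hball⟩ := Metric.isOpen_iff.1 hO _ htO
  filter_upwards [key δ hδ] with n ⟨k, hk, hfp, hkd⟩
  rw [mem_preimage, FP_sum (w := fun k : ℕ => g (k * (T / ((n : ℝ) + 1)), f (k * (T / ((n : ℝ) + 1))))) hk hfp]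
  have hle : tau a f ≤ k * (T / ((n : ℝ) + 1)) := tau_le (grid_mem hT hk).1 hfp.1
  refine hsub ⟨hball ?_, hle⟩
  rw [Metric.mem_ball, Real.dist_eq, abs_lt]
  constructor <;> linarith

structure LP {Ω : Type*} [MeasurableSpace Ω] (μ : Measure Ω) (Y : ℝ → Ω → ℝ) : Prop where
  meas : ∀ t, Measurable (Y t)
  zero : ∀ ω, Y 0 ω = 0
  good : ∀ᵐ ω ∂μ, Good (fun t => Y t ω)
  stat : ∀ s t : ℝ, 0 ≤ s → s ≤ t → μ.map (fun ω => Y t ω - Y s ω) = μ.map (Y (t - s))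
  incr : ∀ (n : ℕ) (t : Fin (n + 1) → ℝ), (∀ i, 0 ≤ t i) → StrictMono t →
      iIndepFun (fun i : Fin n => fun ω => Y (t i.succ) ω - Y (t i.castSucc) ω) μ

namespace LP
variable {Ω : Type*} [MeasurableSpace Ω] {μ : Measure Ω} {Y : ℝ → Ω → ℝ}

lemma indep (hY : LP μ Y) (k : ℕ) (u : Fin (k + 2) → ℝ) (hu : StrictMono u) (h0 : u 0 = 0) :
    IndepFun (fun ω (i : Fin (k + 1)) => Y (u i.castSucc) ω)
      (fun ω => Y (u (Fin.last (k + 1))) ω - Y (u (Fin.last k).castSucc) ω) μ := by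
  have hI := hY.incr (k + 1) u (fun i => h0 ▸ hu.monotone (Fin.zero_le i)) hu
  have hm : ∀ i : Fin (k + 1), Measurable (fun ω => Y (u i.succ) ω - Y (u i.castSucc) ω) :=
    fun i => (hY.meas _).sub (hY.meas _)
  have hd : Disjoint (Finset.univ.erase (Fin.last k)) {Fin.last k} := by simp
  have h2 := hI.indepFun_finset _ _ hd hm
  let φ : ((Finset.univ.erase (Fin.last k) : Finset (Fin (k + 1))) → ℝ) → (Fin (k + 1) → ℝ) :=
    fun v i => ∑ j : Fin i, v ⟨⟨j, by omega⟩, by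
      simp only [Finset.mem_erase, Finset.mem_univ, and_true, ne_eq, Fin.ext_iff, Fin.val_last]
      have := j.2; have := i.2; omega⟩
  have hφ : Measurable φ := by fun_prop
  have h3 := h2.comp hφ (measurable_pi_apply (⟨Fin.last k, by simp⟩ : ({Fin.last k} : Finset (Fin (k + 1)))))
  convert h3 using 1
  swap
  · rfl
  ext ω i
  simp only [φ, Function.comp]
  let w : ℕ → ℝ := fun j => if h : j < k + 2 then Y (u ⟨j, h⟩) ω else 0
  have := Finset.sum_range_sub w i
  rw [Finset.sum_range] at this
  have hw : w i - w 0 = Y (u i.castSucc) ω := by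
    have h1 : (i : ℕ) < k + 2 := by omega
    have h2 : w i = Y (u i.castSucc) ω := by simp only [w, dif_pos h1]; rfl
    have h3 : w 0 = 0 := by
      simp only [w, dif_pos (show 0 < k + 2 by omega)]
      change Y (u 0) ω = 0
      rw [h0, hY.zero]
    rw [h2, h3, sub_zero]
  rw [← hw, ← this]
  refine Finset.sum_congr rfl fun j _ => ?_
  have hj1 : (j : ℕ) + 1 < k + 2 := by omega
  have hj2 : (j : ℕ) < k + 2 := by omega
  simp only [w, dif_pos hj1, dif_pos hj2]
  rfl

lemma indep_grid (hY : LP μ Y) {h : ℝ} (hh : 0 < h) {k N : ℕ} (hk : k < N) :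
    IndepFun (fun ω (i : Fin (k + 1)) => Y (i * h) ω) (fun ω => Y (N * h) ω - Y (k * h) ω) μ := by
  have := hY.indep k (fun i => if (i : ℕ) ≤ k then i * h else N * h) (by
    intro i j hij
    have hij' : (i : ℕ) < j := hij
    simp only
    have hi : (i : ℕ) ≤ k := by omega
    rw [if_pos hi]
    split_ifs with hj
    · have : ((i : ℕ) : ℝ) < (j : ℕ) := by exact_mod_cast hij'
      gcongr
    · have : ((i : ℕ) : ℝ) < N := by exact_mod_cast (by omega)
      gcongr) (by simp)
  convert this using 1
  · ext ω i
    simp only [Fin.val_castSucc]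
    rw [if_pos (by omega)]
  · ext ω
    simp

lemma indep2 (hY : LP μ Y) {s t : ℝ} (hs : 0 < s) (ht : 0 < t) :
    IndepFun (Y s) (fun ω => Y (s + t) ω - Y s ω) μ := by
  have := hY.indep 1 ![0, s, s + t] (by
    rw [Fin.strictMono_iff_lt_succ]
    intro i; fin_cases i <;> simp [hs, ht]) (by simp)
  exact this.comp (measurable_pi_apply (1 : Fin 2)) measurable_id

noncomputable def lm (μ : Measure Ω) (Y : ℝ → Ω → ℝ) (θ t : ℝ) : ENNReal :=
  ∫⁻ ω, ENNReal.ofReal (Real.exp (θ * Y t ω)) ∂μ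

lemma lm_incr (hY : LP μ Y) (θ : ℝ) {s t : ℝ} (hs : 0 ≤ s) (hst : s ≤ t) :
    ∫⁻ ω, ENNReal.ofReal (Real.exp (θ * (Y t ω - Y s ω))) ∂μ = lm μ Y θ (t - s) := by
  have hg : Measurable (fun z : ℝ => ENNReal.ofReal (Real.exp (θ * z))) := by fun_prop
  rw [lm, ← lintegral_map hg (hY.meas _), ← hY.stat s t hs hst,
    lintegral_map hg (show Measurable (fun ω => Y t ω - Y s ω) from (hY.meas _).sub (hY.meas _))]

lemma lm_zero (hY : LP μ Y) [IsProbabilityMeasure μ] (θ : ℝ) : lm μ Y θ 0 = 1 := by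
  simp [lm, hY.zero]

lemma lm_add (hY : LP μ Y) [IsProbabilityMeasure μ] (θ : ℝ) {s t : ℝ} (hs : 0 ≤ s) (ht : 0 ≤ t) :
    lm μ Y θ (s + t) = lm μ Y θ s * lm μ Y θ t := by
  rcases hs.eq_or_lt with rfl | hs'
  · simp [hY.lm_zero]
  rcases ht.eq_or_lt with rfl | ht'
  · simp [hY.lm_zero]
  have hg : Measurable (fun z : ℝ => ENNReal.ofReal (Real.exp (θ * z))) := by fun_prop
  have h1 := hY.lm_incr θ hs (show s ≤ s + t by linarith)
  rw [add_sub_cancel_left] at h1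
  rw [← h1, lm, lm]
  have := lintegral_mul_eq_lintegral_mul_lintegral_of_indepFun
    (hg.comp (hY.meas s)) (hg.comp ((hY.meas (s + t)).sub (hY.meas s)))
    ((hY.indep2 hs' ht').comp hg hg)
  simp only [Function.comp_def, Pi.mul_apply, Pi.sub_apply] at this
  rw [← this]
  refine lintegral_congr fun ω => ?_
  rw [← ENNReal.ofReal_mul (by positivity), ← Real.exp_add]
  congr 2; ring

lemma lm_nsmul (hY : LP μ Y) [IsProbabilityMeasure μ] (θ : ℝ) {t : ℝ} (ht : 0 ≤ t) (n : ℕ) :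
    lm μ Y θ (n * t) = lm μ Y θ t ^ n := by
  induction n with
  | zero => simp [hY.lm_zero]
  | succ n ih =>
    rw [pow_succ, ← ih, ← hY.lm_add θ (by positivity) ht]
    congr 1; push_cast; ring

lemma lm_le (hY : LP μ Y) [IsProbabilityMeasure μ] {θ c : ℝ}
    (h1 : lm μ Y θ 1 = ENNReal.ofReal (Real.exp c)) {t : ℝ} (ht : 0 ≤ t) :
    lm μ Y θ t ≤ ENNReal.ofReal (Real.exp (c * t)) := by
  have hrat : ∀ m n : ℕ, lm μ Y θ (m * (1 / ((n : ℝ) + 1))) = ENNReal.ofReal (Real.exp (c * (m * (1 / ((n : ℝ) + 1))))) := by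
    intro m n
    have hn1 : (0 : ℝ) < (n : ℝ) + 1 := by positivity
    have a1 : lm μ Y θ (1 / ((n : ℝ) + 1)) = ENNReal.ofReal (Real.exp (c * (1 / ((n : ℝ) + 1)))) := by
      have := hY.lm_nsmul θ (t := 1 / ((n : ℝ) + 1)) (by positivity) (n + 1)
      push_cast at this
      rw [mul_one_div_cancel hn1.ne', h1] at this
      have e : ENNReal.ofReal (Real.exp c) = ENNReal.ofReal (Real.exp (c * (1 / ((n : ℝ) + 1)))) ^ (n + 1) := by
        rw [← ENNReal.ofReal_pow (by positivity), ← Real.exp_nat_mul]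
        congr 2; push_cast; field_simp
      rw [e] at this
      exact (ENNReal.pow_right_strictMono (Nat.succ_ne_zero n)).injective this.symm
    rw [hY.lm_nsmul θ (by positivity), a1, ← ENNReal.ofReal_pow (by positivity), ← Real.exp_nat_mul]
    congr 2; ring
  let u : ℕ → ℝ := fun n => ((⌈t * ((n : ℝ) + 1)⌉₊ : ℕ) : ℝ) * (1 / ((n : ℝ) + 1))
  have hu1 : ∀ n, t ≤ u n := by
    intro n
    have hn1 : (0 : ℝ) < (n : ℝ) + 1 := by positivity
    have := Nat.le_ceil (t * ((n : ℝ) + 1))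
    simp only [u]
    rw [mul_one_div, le_div_iff₀ hn1]; exact this
  have hu2 : ∀ n : ℕ, u n ≤ t + 1 / ((n : ℝ) + 1) := by
    intro n
    have hn1 : (0 : ℝ) < (n : ℝ) + 1 := by positivity
    have := (Nat.ceil_lt_add_one (show 0 ≤ t * ((n : ℝ) + 1) by positivity)).le
    simp only [u]
    rw [mul_one_div, div_le_iff₀ hn1, add_mul, one_div_mul_cancel hn1.ne']; exact this
  have hut : Tendsto u atTop (𝓝 t) := by
    refine tendsto_of_tendsto_of_tendsto_of_le_of_le tendsto_const_nhds ?_ hu1 hu2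
    have := (tendsto_one_div_add_atTop_nhds_zero_nat (𝕜 := ℝ)).const_add t
    simpa using this
  have hut' : Tendsto u atTop (𝓝[≥] t) :=
    tendsto_nhdsWithin_iff.2 ⟨hut, Eventually.of_forall hu1⟩
  calc lm μ Y θ t ≤ ∫⁻ ω, liminf (fun n => ENNReal.ofReal (Real.exp (θ * Y (u n) ω))) atTop ∂μ := by
        refine lintegral_mono_ae ?_
        filter_upwards [hY.good] with ω hω
        have e1 : Tendsto (fun n => Y (u n) ω) atTop (𝓝 (Y t ω)) := (hω.1 t ht).1.tendsto.comp hut'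
        have e2 : Tendsto (fun n => ENNReal.ofReal (Real.exp (θ * Y (u n) ω))) atTop
            (𝓝 (ENNReal.ofReal (Real.exp (θ * Y t ω)))) :=
          ENNReal.tendsto_ofReal ((Real.continuous_exp.tendsto _).comp (e1.const_mul θ))
        exact e2.liminf_eq.ge
    _ ≤ liminf (fun n => lm μ Y θ (u n)) atTop := by
        refine lintegral_liminf_le fun n => ?_
        have := hY.meas (u n)
        fun_prop
    _ = ENNReal.ofReal (Real.exp (c * t)) := by
        refine Tendsto.liminf_eq ?_
        have : ∀ n, lm μ Y θ (u n) = ENNReal.ofReal (Real.exp (c * u n)) := fun n => hrat _ n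
        simp_rw [this]
        exact ENNReal.tendsto_ofReal ((Real.continuous_exp.tendsto _).comp (hut.const_mul c))

lemma lm_eq (hY : LP μ Y) [IsProbabilityMeasure μ] {θ c : ℝ}
    (h1 : lm μ Y θ 1 = ENNReal.ofReal (Real.exp c)) {t : ℝ} (ht : 0 ≤ t) :
    lm μ Y θ t = ENNReal.ofReal (Real.exp (c * t)) := by
  refine le_antisymm (hY.lm_le h1 ht) ?_
  obtain ⟨m, hm⟩ := exists_nat_ge t
  have a1 := hY.lm_add θ ht (show 0 ≤ (m : ℝ) - t by linarith)
  rw [add_sub_cancel] at a1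
  have a2 := hY.lm_nsmul θ zero_le_one m
  rw [mul_one, h1, ← ENNReal.ofReal_pow (by positivity), ← Real.exp_nat_mul] at a2
  have a3 := hY.lm_le h1 (show 0 ≤ (m : ℝ) - t by linarith)
  have a4 : ENNReal.ofReal (Real.exp (c * t)) * ENNReal.ofReal (Real.exp (c * (m - t)))
      ≤ lm μ Y θ t * ENNReal.ofReal (Real.exp (c * (m - t))) := by
    rw [← ENNReal.ofReal_mul (by positivity), ← Real.exp_add,
      show c * t + c * (m - t) = m * c by ring, ← a2, a1]
    gcongr
  exact (ENNReal.mul_le_mul_iff_left (by simp [Real.exp_pos]) (by simp)).1 a4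

end LP

lemma tendsto_of_sq {Ω : Type*} [MeasurableSpace Ω] {μ : Measure Ω} [IsProbabilityMeasure μ]
    {Z : ℕ → Ω → ℝ} {W : Ω → ℝ} {B C : ℝ} (hZ0 : ∀ n ω, 0 ≤ Z n ω) (hZm : ∀ n, Measurable (Z n))
    (hZ : ∀ n, Integrable (Z n) μ) (hZ2 : ∀ n, Integrable (fun ω => Z n ω ^ 2) μ)
    (hC : ∀ n, ∫ ω, Z n ω ^ 2 ∂μ ≤ C) (hB : ∀ᵐ ω ∂μ, W ω ≤ B)
    (hlim : ∀ᵐ ω ∂μ, Tendsto (fun n => Z n ω) atTop (𝓝 (W ω))) :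
    Tendsto (fun n => ∫ ω, Z n ω ∂μ) atTop (𝓝 (∫ ω, W ω ∂μ)) := by
  have hC0 : 0 ≤ C := (integral_nonneg fun ω => sq_nonneg _).trans (hC 0)
  rw [Metric.tendsto_atTop]
  intro ε hε
  obtain ⟨K, hK0, hKB, hKC⟩ : ∃ K : ℝ, 0 < K ∧ B ≤ K ∧ C / K < ε / 2 := by
    refine ⟨max (max B 1) (2 * C / ε + 1), ?_, ?_, ?_⟩
    · exact lt_of_lt_of_le one_pos ((le_max_right _ _).trans (le_max_left _ _))
    · exact (le_max_left _ _).trans (le_max_left _ _)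
    · have h1 : 2 * C / ε < max (max B 1) (2 * C / ε + 1) := lt_of_lt_of_le (by linarith) (le_max_right _ _)
      have h0 : 0 < max (max B 1) (2 * C / ε + 1) :=
        lt_of_lt_of_le one_pos ((le_max_right _ _).trans (le_max_left _ _))
      rw [div_lt_iff₀ h0]
      rw [div_lt_iff₀ hε] at h1
      linarith
  have hmin : Tendsto (fun n => ∫ ω, min (Z n ω) K ∂μ) atTop (𝓝 (∫ ω, W ω ∂μ)) := by
    refine tendsto_integral_of_dominated_convergence (fun _ => K) ?_ (integrable_const _) ?_ ?_
    · intro n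
      exact ((hZm n).min measurable_const).aestronglyMeasurable
    · intro n
      refine Eventually.of_forall fun ω => ?_
      rw [Real.norm_of_nonneg (le_min (hZ0 n ω) hK0.le)]
      exact min_le_right _ _
    · filter_upwards [hlim, hB] with ω h1 h2
      have := h1.min (tendsto_const_nhds (x := K))
      rwa [min_eq_left (h2.trans hKB)] at this
  obtain ⟨N, hN⟩ := Metric.tendsto_atTop.1 hmin (ε / 2) (half_pos hε)
  refine ⟨N, fun n hn => ?_⟩
  have h1 := hN n hn
  have hI : Integrable (fun ω => min (Z n ω) K) μ := (hZ n).inf (integrable_const K)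
  have h2 : ∫ ω, Z n ω ∂μ ≤ ∫ ω, min (Z n ω) K ∂μ + C / K := by
    calc ∫ ω, Z n ω ∂μ ≤ ∫ ω, (min (Z n ω) K + Z n ω ^ 2 / K) ∂μ := by
          refine integral_mono (hZ n) (hI.add ((hZ2 n).div_const K)) fun ω => ?_
          simp only
          rcases le_total (Z n ω) K with h | h
          · rw [min_eq_left h]
            have : 0 ≤ Z n ω ^ 2 / K := by positivity
            linarith
          · rw [min_eq_right h]
            have : Z n ω ≤ Z n ω ^ 2 / K := by
              rw [le_div_iff₀ hK0]; nlinarith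
            linarith
      _ = ∫ ω, min (Z n ω) K ∂μ + (∫ ω, Z n ω ^ 2 ∂μ) / K := by
          rw [integral_add hI ((hZ2 n).div_const K), integral_div]
      _ ≤ _ := by gcongr; exact hC n
  have h3 : ∫ ω, min (Z n ω) K ∂μ ≤ ∫ ω, Z n ω ∂μ :=
    integral_mono hI (hZ n) fun ω => min_le_left _ _
  rw [Real.dist_eq, abs_lt] at h1 ⊢
  constructor <;> linarith

namespace LP
variable {Ω : Type*} [MeasurableSpace Ω] {μ : Measure Ω} {Y : ℝ → Ω → ℝ}

lemma meas_FP (hY : LP μ Y) (a h : ℝ) (k : ℕ) :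
    MeasurableSet {ω | FP a (fun k => Y (k * h) ω) k} := by
  unfold FP
  have h1 : MeasurableSet {ω | a < Y (k * h) ω} := measurableSet_lt measurable_const (hY.meas _)
  have h2 : MeasurableSet {ω | ∀ j < k, Y (j * h) ω ≤ a} := by
    simp only [ofPred_forall]
    exact MeasurableSet.iInter fun j => MeasurableSet.iInter fun _ =>
      measurableSet_le (hY.meas _) measurable_const
  exact h1.inter h2

open Classical in
lemma os_k (hY : LP μ Y) [IsProbabilityMeasure μ] {θ c : ℝ}
    (hm : ∀ t, 0 ≤ t → lm μ Y θ t = ENNReal.ofReal (Real.exp (c * t))) {h : ℝ} (hh : 0 < h) (a : ℝ)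
    {k N : ℕ} (hk : k ≤ N) :
    ∫⁻ ω, (if FP a (fun k => Y (k * h) ω) k then ENNReal.ofReal (Real.exp (θ * Y (k * h) ω - c * (k * h))) else 0) ∂μ
    = ∫⁻ ω, (if FP a (fun k => Y (k * h) ω) k then ENNReal.ofReal (Real.exp (θ * Y (N * h) ω - c * (N * h))) else 0) ∂μ := by
  rcases hk.eq_or_lt with rfl | hk
  · rfl
  let F : (Fin (k + 1) → ℝ) → ENNReal := fun v =>
    if a < v (Fin.last k) ∧ ∀ j : Fin k, v j.castSucc ≤ a then
      ENNReal.ofReal (Real.exp (θ * v (Fin.last k) - c * (k * h))) else 0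
  let G : ℝ → ENNReal := fun z => ENNReal.ofReal (Real.exp (θ * z - c * (N * h - k * h)))
  have hF : Measurable F := by
    refine Measurable.ite ?_ (by fun_prop) measurable_const
    have h1 : MeasurableSet {v : Fin (k + 1) → ℝ | a < v (Fin.last k)} :=
      measurableSet_lt measurable_const (measurable_pi_apply _)
    have h2 : MeasurableSet {v : Fin (k + 1) → ℝ | ∀ j : Fin k, v j.castSucc ≤ a} := by
      simp only [ofPred_forall]
      exact MeasurableSet.iInter fun j => measurableSet_le (measurable_pi_apply _) measurable_const
    exact h1.inter h2
  have hG : Measurable G := by fun_prop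
  have hFk : ∀ ω, F (fun i : Fin (k + 1) => Y (i * h) ω) =
      (if FP a (fun k => Y (k * h) ω) k then ENNReal.ofReal (Real.exp (θ * Y (k * h) ω - c * (k * h))) else 0) := by
    intro ω
    simp only [F, FP, Fin.val_last, Fin.val_castSucc]
    congr 1
    apply propext
    refine and_congr Iff.rfl ⟨fun H j hj => H ⟨j, hj⟩, fun H j => H j j.2⟩
  have hv : Measurable (fun ω (i : Fin (k + 1)) => Y (i * h) ω) :=
    measurable_pi_lambda _ fun i => hY.meas _
  have hd : Measurable (fun ω => Y (N * h) ω - Y (k * h) ω) := (hY.meas _).sub (hY.meas _)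
  have key := lintegral_mul_eq_lintegral_mul_lintegral_of_indepFun
    (hF.comp hv) (hG.comp hd) ((hY.indep_grid hh hk).comp hF hG)
  have hkN : (k : ℝ) * h ≤ N * h := by
    have : (k : ℝ) ≤ N := by exact_mod_cast hk.le
    gcongr
  have hG1 : ∫⁻ ω, G (Y (N * h) ω - Y (k * h) ω) ∂μ = 1 := by
    have e1 := hY.lm_incr θ (s := k * h) (t := N * h) (by positivity) hkN
    rw [hm _ (by linarith)] at e1
    have : ∀ ω, G (Y (N * h) ω - Y (k * h) ω) = ENNReal.ofReal (Real.exp (θ * (Y (N * h) ω - Y (k * h) ω)))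
        * ENNReal.ofReal (Real.exp (-(c * (N * h - k * h)))) := by
      intro ω
      rw [← ENNReal.ofReal_mul (by positivity), ← Real.exp_add]
      rfl
    simp_rw [this]
    rw [lintegral_mul_const' _ _ (by simp), e1, ← ENNReal.ofReal_mul (by positivity), ← Real.exp_add]
    simp
  simp only [Function.comp_def, Pi.mul_apply, hFk, hG1, mul_one] at key
  rw [← key]
  refine lintegral_congr fun ω => ?_
  split_ifs
  · rw [← ENNReal.ofReal_mul (by positivity), ← Real.exp_add]
    congr 2; ring
  · simp

open Classical in
/-- stopped value -/
noncomputable def SV (Y : ℝ → Ω → ℝ) (a h θ c : ℝ) (N : ℕ) (ω : Ω) : ℝ :=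
  ∑ k ∈ Finset.range (N + 1), if FP a (fun k => Y (k * h) ω) k then Real.exp (θ * Y (k * h) ω - c * (k * h)) else 0

open Classical in
/-- indicator of passage -/
noncomputable def IV (Y : ℝ → Ω → ℝ) (a h : ℝ) (N : ℕ) (ω : Ω) : ℝ :=
  ∑ k ∈ Finset.range (N + 1), if FP a (fun k => Y (k * h) ω) k then 1 else 0

lemma meas_SV (hY : LP μ Y) (a h θ c : ℝ) (N : ℕ) : Measurable (SV Y a h θ c N) := by
  unfold SV
  refine Finset.measurable_sum _ fun k _ => Measurable.ite (hY.meas_FP a h k) ?_ measurable_const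
  have := hY.meas (k * h)
  fun_prop

lemma meas_IV (hY : LP μ Y) (a h : ℝ) (N : ℕ) : Measurable (IV Y a h N) := by
  unfold IV
  exact Finset.measurable_sum _ fun k _ => Measurable.ite (hY.meas_FP a h k) measurable_const measurable_const

lemma SV_nonneg (a h θ c : ℝ) (N : ℕ) (ω : Ω) : 0 ≤ SV Y a h θ c N ω := by
  refine Finset.sum_nonneg fun k _ => ?_
  split_ifs <;> positivity

lemma IV_SV (a h : ℝ) (N : ℕ) (ω : Ω) : IV Y a h N ω = 0 ∧ (∀ θ c, SV Y a h θ c N ω = 0) ∨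
    IV Y a h N ω = 1 ∧ ∃ k ≤ N, ∀ θ c, SV Y a h θ c N ω = Real.exp (θ * Y (k * h) ω - c * (k * h)) := by
  classical
  by_cases H : ∃ k ≤ N, FP a (fun k => Y (k * h) ω) k
  · obtain ⟨k, hk, hfp⟩ := H
    right
    refine ⟨FP_sum (w := fun _ => 1) hk hfp, k, hk, fun θ c => ?_⟩
    exact FP_sum (w := fun k : ℕ => Real.exp (θ * Y (k * h) ω - c * (k * h))) hk hfp
  · left
    push Not at H
    constructor
    · exact Finset.sum_eq_zero fun k hk => if_neg (H k (by have := Finset.mem_range.1 hk; omega))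
    · intro θ c
      exact Finset.sum_eq_zero fun k hk => if_neg (H k (by have := Finset.mem_range.1 hk; omega))

lemma os (hY : LP μ Y) [IsProbabilityMeasure μ] {θ c : ℝ}
    (hm : ∀ t, 0 ≤ t → lm μ Y θ t = ENNReal.ofReal (Real.exp (c * t))) {h : ℝ} (hh : 0 < h) (a : ℝ)
    (N : ℕ) :
    ∫⁻ ω, ENNReal.ofReal (SV Y a h θ c N ω) ∂μ =
    ∫⁻ ω, ENNReal.ofReal (IV Y a h N ω * Real.exp (θ * Y (N * h) ω - c * (N * h))) ∂μ := by
  classical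
  have h1 : ∀ ω, ENNReal.ofReal (SV Y a h θ c N ω) = ∑ k ∈ Finset.range (N + 1),
      (if FP a (fun k => Y (k * h) ω) k then ENNReal.ofReal (Real.exp (θ * Y (k * h) ω - c * (k * h))) else 0) := by
    intro ω
    rw [SV, ENNReal.ofReal_sum_of_nonneg]
    · refine Finset.sum_congr rfl fun k _ => ?_
      split_ifs <;> simp
    · intro k _; split_ifs <;> positivity
  have h2 : ∀ ω, ENNReal.ofReal (IV Y a h N ω * Real.exp (θ * Y (N * h) ω - c * (N * h))) = ∑ k ∈ Finset.range (N + 1),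
      (if FP a (fun k => Y (k * h) ω) k then ENNReal.ofReal (Real.exp (θ * Y (N * h) ω - c * (N * h))) else 0) := by
    intro ω
    rw [IV, Finset.sum_mul, ENNReal.ofReal_sum_of_nonneg]
    · refine Finset.sum_congr rfl fun k _ => ?_
      split_ifs <;> simp
    · intro k _; split_ifs <;> positivity
  simp_rw [h1, h2]
  rw [lintegral_finsetSum, lintegral_finsetSum]
  · refine Finset.sum_congr rfl fun k hk => hY.os_k hm hh a ?_
    have := Finset.mem_range.1 hk
    omega
  · intro k _
    refine Measurable.ite (hY.meas_FP a h k) ?_ measurable_const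
    have := hY.meas (N * h)
    fun_prop
  · intro k _
    refine Measurable.ite (hY.meas_FP a h k) ?_ measurable_const
    have := hY.meas (k * h)
    fun_prop

lemma int_exp (hY : LP μ Y) {θ c : ℝ}
    (hm : ∀ t, 0 ≤ t → lm μ Y θ t = ENNReal.ofReal (Real.exp (c * t))) {t : ℝ} (ht : 0 ≤ t) :
    Integrable (fun ω => Real.exp (θ * Y t ω - c * t)) μ ∧ ∫ ω, Real.exp (θ * Y t ω - c * t) ∂μ = 1 := by
  have hmm : Measurable (fun ω => Real.exp (θ * Y t ω)) := by
    have := hY.meas t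
    fun_prop
  have h1 : Integrable (fun ω => Real.exp (θ * Y t ω)) μ := by
    refine ⟨hmm.aestronglyMeasurable, ?_⟩
    rw [hasFiniteIntegral_iff_ofReal (Eventually.of_forall fun ω => by positivity)]
    have := hm t ht
    rw [lm] at this
    rw [this]; simp
  have h2 : ∫ ω, Real.exp (θ * Y t ω) ∂μ = Real.exp (c * t) := by
    rw [integral_eq_lintegral_of_nonneg_ae (Eventually.of_forall fun ω => by positivity) hmm.aestronglyMeasurable]
    have := hm t ht
    rw [lm] at this
    rw [this, ENNReal.toReal_ofReal (by positivity)]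
  simp_rw [sub_eq_add_neg, Real.exp_add]
  refine ⟨h1.mul_const _, ?_⟩
  rw [integral_mul_const, h2, ← Real.exp_add]; simp

open Classical in
lemma fpt (hY : LP μ Y) [IsProbabilityMeasure μ] {θ c c2 : ℝ} (hc : 0 ≤ c)
    (hm : ∀ t, 0 ≤ t → lm μ Y θ t = ENNReal.ofReal (Real.exp (c * t)))
    (hm2 : ∀ t, 0 ≤ t → lm μ Y (2 * θ) t = ENNReal.ofReal (Real.exp (c2 * t)))
    {a T : ℝ} (ha : 0 < a) (hT : 0 < T) :
    ∫ ω, (if ∃ s ∈ Icc 0 T, a < Y s ω then Real.exp (θ * Y T ω - c * T) else 0) ∂μ =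
    ∫ ω, (if ∃ s ∈ Icc 0 T, a < Y s ω then Real.exp (θ * a - c * tau a (fun t => Y t ω)) else 0) ∂μ := by
  have hh : ∀ n : ℕ, 0 < T / ((n : ℝ) + 1) := fun n => by positivity
  have hNh : ∀ n : ℕ, ((n + 1 : ℕ) : ℝ) * (T / ((n : ℝ) + 1)) = T := fun n => by
    push_cast
    exact mul_div_cancel₀ _ (by positivity)
  have hIE : ∀ n : ℕ, Integrable (fun ω => IV Y a (T / ((n : ℝ) + 1)) (n + 1) ω * Real.exp (θ * Y T ω - c * T)) μ := by
    intro n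
    refine (hY.int_exp hm hT.le).1.mono ?_ ?_
    · have h1 := hY.meas_IV a (T / ((n : ℝ) + 1)) (n + 1)
      have h2 := hY.meas T
      exact (by fun_prop : Measurable _).aestronglyMeasurable
    · refine Eventually.of_forall fun ω => ?_
      rcases IV_SV (Y := Y) a (T / ((n : ℝ) + 1)) (n + 1) ω with ⟨h, _⟩ | ⟨h, _⟩ <;> simp [h, Real.exp_nonneg]
  have hos : ∀ n : ℕ, Integrable (SV Y a (T / ((n : ℝ) + 1)) θ c (n + 1)) μ ∧
      ∫ ω, SV Y a (T / ((n : ℝ) + 1)) θ c (n + 1) ω ∂μ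
        = ∫ ω, IV Y a (T / ((n : ℝ) + 1)) (n + 1) ω * Real.exp (θ * Y T ω - c * T) ∂μ := by
    intro n
    have e := hY.os hm (hh n) a (n + 1)
    rw [hNh] at e
    have hnn : ∀ ω, 0 ≤ IV Y a (T / ((n : ℝ) + 1)) (n + 1) ω * Real.exp (θ * Y T ω - c * T) := by
      intro ω
      rcases IV_SV (Y := Y) a (T / ((n : ℝ) + 1)) (n + 1) ω with ⟨h, _⟩ | ⟨h, _⟩ <;> simp [h, Real.exp_nonneg]
    constructor
    · refine ⟨(hY.meas_SV _ _ _ _ _).aestronglyMeasurable, ?_⟩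
      rw [hasFiniteIntegral_iff_ofReal (Eventually.of_forall fun ω => SV_nonneg _ _ _ _ _ ω), e]
      exact (hasFiniteIntegral_iff_ofReal (Eventually.of_forall hnn)).1 (hIE n).2
    · rw [integral_eq_lintegral_of_nonneg_ae (Eventually.of_forall fun ω => SV_nonneg _ _ _ _ _ ω)
        (hY.meas_SV _ _ _ _ _).aestronglyMeasurable, e,
        integral_eq_lintegral_of_nonneg_ae (Eventually.of_forall hnn) (hIE n).1]
  -- second moment
  have hsq : ∀ n : ℕ, Integrable (SV Y a (T / ((n : ℝ) + 1)) (2 * θ) c2 (n + 1)) μ ∧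
      ∫ ω, SV Y a (T / ((n : ℝ) + 1)) (2 * θ) c2 (n + 1) ω ∂μ ≤ 1 := by
    intro n
    have e := hY.os hm2 (hh n) a (n + 1)
    rw [hNh] at e
    have e2 : ∫⁻ ω, ENNReal.ofReal (SV Y a (T / ((n : ℝ) + 1)) (2 * θ) c2 (n + 1) ω) ∂μ ≤ 1 := by
      rw [e]
      have h1 := (hY.int_exp hm2 hT.le)
      have h2 := ofReal_integral_eq_lintegral_ofReal h1.1 (Eventually.of_forall fun ω => by positivity)
      rw [h1.2, ENNReal.ofReal_one] at h2
      rw [h2]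
      refine lintegral_mono fun ω => ENNReal.ofReal_le_ofReal ?_
      rcases IV_SV (Y := Y) a (T / ((n : ℝ) + 1)) (n + 1) ω with ⟨h, _⟩ | ⟨h, _⟩ <;> simp [h, Real.exp_nonneg]
    constructor
    · refine ⟨(hY.meas_SV _ _ _ _ _).aestronglyMeasurable, ?_⟩
      rw [hasFiniteIntegral_iff_ofReal (Eventually.of_forall fun ω => SV_nonneg _ _ _ _ _ ω)]
      exact e2.trans_lt (by simp)
    · rw [integral_eq_lintegral_of_nonneg_ae (Eventually.of_forall fun ω => SV_nonneg _ _ _ _ _ ω)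
        (hY.meas_SV _ _ _ _ _).aestronglyMeasurable]
      exact ENNReal.toReal_le_of_le_ofReal zero_le_one (by simpa using e2)
  have hsqle : ∀ (n : ℕ) ω, SV Y a (T / ((n : ℝ) + 1)) θ c (n + 1) ω ^ 2 ≤
      Real.exp (|c2 - 2 * c| * T) * SV Y a (T / ((n : ℝ) + 1)) (2 * θ) c2 (n + 1) ω := by
    intro n ω
    rcases IV_SV (Y := Y) a (T / ((n : ℝ) + 1)) (n + 1) ω with ⟨_, h⟩ | ⟨_, k, hk, h⟩
    · simp [h]
    · rw [h, h, ← Real.exp_nat_mul, ← Real.exp_add]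
      apply Real.exp_le_exp.2
      obtain ⟨g1, g2⟩ := grid_mem hT hk
      have : (c2 - 2 * c) * (k * (T / ((n : ℝ) + 1))) ≤ |c2 - 2 * c| * T :=
        (mul_le_mul_of_nonneg_right (le_abs_self _) g1).trans (mul_le_mul_of_nonneg_left g2 (abs_nonneg _))
      push_cast
      linarith
  have hsqI : ∀ n : ℕ, Integrable (fun ω => SV Y a (T / ((n : ℝ) + 1)) θ c (n + 1) ω ^ 2) μ := by
    intro n
    refine ((hsq n).1.const_mul (Real.exp (|c2 - 2 * c| * T))).mono ?_ ?_
    · exact ((hY.meas_SV _ _ _ _ _).pow_const 2).aestronglyMeasurable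
    · refine Eventually.of_forall fun ω => ?_
      rw [Real.norm_of_nonneg (sq_nonneg _)]
      exact (hsqle n ω).trans (le_abs_self _)
  have lim1 : Tendsto (fun n : ℕ => ∫ ω, SV Y a (T / ((n : ℝ) + 1)) θ c (n + 1) ω ∂μ) atTop
      (𝓝 (∫ ω, (if ∃ s ∈ Icc 0 T, a < Y s ω then Real.exp (θ * a - c * tau a (fun t => Y t ω)) else 0) ∂μ)) := by
    refine tendsto_of_sq (B := Real.exp (θ * a)) (C := Real.exp (|c2 - 2 * c| * T))
      (fun n ω => SV_nonneg _ _ _ _ _ ω) (fun n => hY.meas_SV _ _ _ _ _) (fun n => (hos n).1) hsqI ?_ ?_ ?_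
    · intro n
      calc _ ≤ ∫ ω, Real.exp (|c2 - 2 * c| * T) * SV Y a (T / ((n : ℝ) + 1)) (2 * θ) c2 (n + 1) ω ∂μ :=
            integral_mono (hsqI n) ((hsq n).1.const_mul _) (hsqle n)
        _ ≤ _ := by
            rw [integral_const_mul]
            exact mul_le_of_le_one_right (by positivity) (hsq n).2
    · filter_upwards [hY.good] with ω hω
      split_ifs with hA
      · obtain ⟨s, hs, has⟩ := hA
        have := (hω.f_tau ha ⟨s, hs.1, has⟩).1
        apply Real.exp_le_exp.2
        nlinarith
      · positivity
    · filter_upwards [hY.good] with ω hω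
      exact hω.grid_fp hT ha (g := fun z => Real.exp (θ * z.2 - c * z.1)) (by fun_prop)
  have lim2 : Tendsto (fun n : ℕ => ∫ ω, SV Y a (T / ((n : ℝ) + 1)) θ c (n + 1) ω ∂μ) atTop
      (𝓝 (∫ ω, (if ∃ s ∈ Icc 0 T, a < Y s ω then Real.exp (θ * Y T ω - c * T) else 0) ∂μ)) := by
    simp_rw [fun n => (hos n).2]
    refine tendsto_integral_of_dominated_convergence (fun ω => Real.exp (θ * Y T ω - c * T))
      (fun n => (hIE n).1) (hY.int_exp hm hT.le).1 ?_ ?_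
    · intro n
      refine Eventually.of_forall fun ω => ?_
      rcases IV_SV (Y := Y) a (T / ((n : ℝ) + 1)) (n + 1) ω with ⟨h, _⟩ | ⟨h, _⟩ <;> simp [h, Real.exp_nonneg]
    · filter_upwards [hY.good] with ω hω
      have := (hω.grid_fp hT ha (g := fun _ => 1) (by fun_prop)).mul_const (Real.exp (θ * Y T ω - c * T))
      rw [ite_mul, one_mul, zero_mul] at this
      exact this
  exact tendsto_nhds_unique lim2 lim1

end LP

lemma layer_pt {x : ℝ} (hx : 0 < x) (z : ℝ) :
    ∫ u in Ioi (0 : ℝ), x * Real.exp (-x * u) * (if u < z then 1 else 0) = 1 - Real.exp (-x * max 0 z) := by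
  have h1 : ∫ u in Ioi (0 : ℝ), x * Real.exp (-x * u) * (if u < z then 1 else 0)
      = ∫ u in (0 : ℝ)..(max 0 z), x * Real.exp (-x * u) := by
    rw [intervalIntegral.integral_of_le (le_max_left _ _), ← integral_indicator measurableSet_Ioi,
      ← integral_indicator measurableSet_Ioc]
    refine integral_congr_ae ?_
    filter_upwards [compl_mem_ae_iff.2 (measure_singleton (μ := volume) z)] with u hu
    have hu : u ≠ z := hu
    simp only [indicator_apply, mem_Ioi, mem_Ioc, le_max_iff]
    by_cases h0 : 0 < u
    · rcases lt_or_gt_of_ne hu with h | h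
      · simp [h0, h, h.le]
      · simp [h0, not_lt.2 h.le, not_le.2 h]
    · simp [h0]
  rw [h1]
  have h2 : ∀ u ∈ uIcc (0 : ℝ) (max 0 z), HasDerivAt (fun u => - Real.exp (-x * u)) (x * Real.exp (-x * u)) u := by
    intro u _
    have := (((hasDerivAt_id u).const_mul (-x)).exp).neg
    exact this.congr_deriv (by simp only [id]; ring)
  rw [intervalIntegral.integral_eq_sub_of_hasDerivAt h2]
  · simp; ring
  · exact (by fun_prop : Continuous fun u : ℝ => x * Real.exp (-x * u)).intervalIntegrable _ _

lemma int_xexp {x : ℝ} (hx : 0 < x) : IntegrableOn (fun u : ℝ => x * Real.exp (-x * u)) (Ioi 0) :=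
  (exp_neg_integrableOn_Ioi 0 hx).const_mul x

lemma integral_exp_Ioi {x : ℝ} (hx : 0 < x) : ∫ u in Ioi (0 : ℝ), Real.exp (-x * u) = 1 / x := by
  have := integral_exp_mul_Ioi (a := -x) (by linarith) 0
  rw [this]; simp

lemma layer {Ω : Type*} [MeasurableSpace Ω] {μ : Measure Ω} [IsProbabilityMeasure μ]
    {W Z : Ω → ℝ} (hW : Integrable W μ) (hZ : Measurable Z) {x : ℝ} (hx : 0 < x) :
    ∫ ω, W ω * Real.exp (-x * max 0 (Z ω)) ∂μ = ∫ ω, W ω ∂μ -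
      ∫ u in Ioi (0 : ℝ), x * Real.exp (-x * u) * ∫ ω, (if u < Z ω then W ω else 0) ∂μ := by
  have hprod : Integrable (fun z : Ω × ℝ => W z.1 * (x * Real.exp (-x * z.2) * (if z.2 < Z z.1 then 1 else 0)))
      (μ.prod (volume.restrict (Ioi 0))) := by
    refine (hW.mul_prod (int_xexp hx)).mono ?_ ?_
    · refine hW.1.comp_fst.mul (Measurable.aestronglyMeasurable ?_)
      refine Measurable.mul (by fun_prop) (Measurable.ite ?_ measurable_const measurable_const)
      exact measurableSet_lt measurable_snd (hZ.comp measurable_fst)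
    · refine Eventually.of_forall fun z => ?_
      simp only [norm_mul]
      split_ifs
      · simp
      · simp; positivity
  have hsw := integral_integral_swap (f := fun ω u => W ω * (x * Real.exp (-x * u) * (if u < Z ω then 1 else 0))) hprod
  have hint := hprod.integral_prod_left
  simp only at hint
  simp_rw [integral_const_mul, layer_pt hx] at hsw hint
  have e1 : ∫ ω, W ω * Real.exp (-x * max 0 (Z ω)) ∂μ = ∫ ω, W ω ∂μ - ∫ ω, W ω * (1 - Real.exp (-x * max 0 (Z ω))) ∂μ := by
    rw [← integral_sub hW hint]
    congr 1; ext ω; ring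
  rw [e1, hsw]
  congr 1
  refine integral_congr_ae (Eventually.of_forall fun u => ?_)
  simp only
  rw [← integral_const_mul]
  congr 1; ext ω
  split_ifs <;> ring

lemma meas_UU : Measurable (fun z : ℝ × (ℝ → ℝ) => UU z.1 z.2) := by
  unfold UU
  refine Measurable.iInf fun n => Measurable.iSup fun r => Measurable.ite ?_ ?_ ?_
  · by_cases hr : 0 ≤ (r : ℝ)
    · simp only [hr, true_and]
      exact measurableSet_lt measurable_const (by fun_prop)
    · simp [hr]
  · exact (measurable_pi_apply (r : ℝ)).comp measurable_snd
  · exact (measurable_pi_apply (0 : ℝ)).comp measurable_snd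

lemma meas_pair {Ω : Type*} [MeasurableSpace Ω] {Y : ℝ → Ω → ℝ} (hY : ∀ t, Measurable (Y t)) :
    Measurable (fun z : ℝ × Ω => (z.1, fun t => Y t z.2)) :=
  Measurable.prodMk measurable_fst (measurable_pi_lambda _ fun t => (hY t).comp measurable_snd)

lemma meas_UU_comp' {Ω : Type*} [MeasurableSpace Ω] {Y : ℝ → Ω → ℝ} (hY : ∀ t, Measurable (Y t)) :
    Measurable ((fun z : ℝ × (ℝ → ℝ) => UU z.1 z.2) ∘ (fun z : ℝ × Ω => (z.1, fun t => Y t z.2))) :=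
  Measurable.comp meas_UU (meas_pair hY)

lemma meas_UU_comp {Ω : Type*} [MeasurableSpace Ω] {Y : ℝ → Ω → ℝ} (hY : ∀ t, Measurable (Y t)) :
    Measurable (fun z : ℝ × Ω => UU z.1 (fun t => Y t z.2)) := by
  have := meas_UU_comp' hY
  rw [Function.comp_def] at this
  exact this

lemma meas_UU_fix' {Ω : Type*} [MeasurableSpace Ω] {Y : ℝ → Ω → ℝ} (hY : ∀ t, Measurable (Y t)) (T : ℝ) :
    Measurable ((fun z : ℝ × Ω => UU z.1 (fun t => Y t z.2)) ∘ (fun ω : Ω => (T, ω))) :=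
  Measurable.comp (meas_UU_comp hY) (Measurable.prodMk measurable_const measurable_id)

lemma meas_UU_fix {Ω : Type*} [MeasurableSpace Ω] {Y : ℝ → Ω → ℝ} (hY : ∀ t, Measurable (Y t)) (T : ℝ) :
    Measurable (fun ω => UU T (fun t => Y t ω)) := by
  have := meas_UU_fix' hY T
  rw [Function.comp_def] at this
  exact this

lemma Cad.lt_UU {f : ℝ → ℝ} (h : Cad f) {t a : ℝ} (ht : 0 ≤ t) :
    a < UU t f ↔ ∃ s ∈ Icc 0 t, a < f s := by
  rw [lt_isLUB_iff (h.isLUB ht)]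
  simp

lemma gsup_neg_rev (N : ℕ) (v : ℕ → ℝ) :
    gsup N (fun k => -(v N - v (N - k))) = gsup N v - v N := by
  unfold gsup
  apply le_antisymm
  · refine Finset.sup'_le _ _ fun k hk => ?_
    have := Finset.le_sup' v (show N - k ∈ Finset.range (N + 1) from Finset.mem_range.2 (by omega))
    linarith
  · rw [sub_le_iff_le_add]
    refine Finset.sup'_le _ _ fun k hk => ?_
    have hk := Finset.mem_range.1 hk
    have := Finset.le_sup' (fun k => -(v N - v (N - k))) (show N - k ∈ Finset.range (N + 1) from Finset.mem_range.2 (by omega))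
    simp only [show N - (N - k) = k by omega] at this
    linarith

namespace LP
variable {Ω : Type*} [MeasurableSpace Ω] {μ : Measure Ω} {Y : ℝ → Ω → ℝ}

lemma rev_law_aux [IsProbabilityMeasure μ] {N : ℕ} (f : Fin N → Ω → ℝ) (hI : iIndepFun f μ)
    (hmeas : ∀ i, Measurable (f i)) (ν : Measure ℝ) (hlaw : ∀ i, μ.map (f i) = ν) :
    μ.map (fun ω i => f i ω) = μ.map (fun ω i => f (Fin.rev i) ω) := by
  have hI' : iIndepFun (fun i => f (Fin.rev i)) μ := hI.precomp (g := Fin.rev) Fin.rev_injective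
  rw [(iIndepFun_iff_map_fun_eq_pi_map (fun i => (hmeas i).aemeasurable)).1 hI,
    (iIndepFun_iff_map_fun_eq_pi_map (f := fun i => f (Fin.rev i)) (fun i => (hmeas i.rev).aemeasurable)).1 hI']
  exact congrArg Measure.pi (funext fun i => (hlaw i).trans (hlaw i.rev).symm)

lemma rev_law (hY : LP μ Y) [IsProbabilityMeasure μ] {h : ℝ} (hh : 0 < h) (N : ℕ) :
    μ.map (fun ω (i : Fin N) => Y (((i : ℕ) + 1 : ℝ) * h) ω - Y ((i : ℕ) * h) ω) =
    μ.map (fun ω (i : Fin N) => Y (((i.rev : ℕ) + 1 : ℝ) * h) ω - Y ((i.rev : ℕ) * h) ω) := by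
  have hI := hY.incr N (fun i => (i : ℕ) * h) (fun i => by positivity) (by
    intro i j hij
    have : ((i : ℕ) : ℝ) < (j : ℕ) := by exact_mod_cast hij
    simp only
    gcongr)
  simp only [Fin.val_succ, Fin.val_castSucc, Nat.cast_add, Nat.cast_one] at hI
  have hmeas : ∀ i : Fin N, Measurable (fun ω => Y (((i : ℕ) + 1 : ℝ) * h) ω - Y ((i : ℕ) * h) ω) :=
    fun i => (hY.meas _).sub (hY.meas _)
  have hlaw : ∀ i : Fin N, μ.map (fun ω => Y (((i : ℕ) + 1 : ℝ) * h) ω - Y ((i : ℕ) * h) ω) = μ.map (Y h) := by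
    intro i
    have h1 : 0 ≤ ((i : ℕ) : ℝ) * h := by positivity
    rw [hY.stat _ _ h1 (by linarith)]
    rw [show ((i : ℕ) + 1 : ℝ) * h - (i : ℕ) * h = h by ring]
  exact rev_law_aux (fun (i : Fin N) ω => Y (((i : ℕ) + 1 : ℝ) * h) ω - Y ((i : ℕ) * h) ω) hI hmeas _ hlaw

lemma rev_grid (hY : LP μ Y) [IsProbabilityMeasure μ] {h : ℝ} (hh : 0 < h) (N : ℕ) (p : ℝ) :
    ∫ ω, Real.exp (-p * gsup N (fun k => -Y (k * h) ω)) ∂μ =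
    ∫ ω, Real.exp (p * (Y (N * h) ω - gsup N (fun k => Y (k * h) ω))) ∂μ := by
  let F : (Fin N → ℝ) → ℝ := fun v =>
    Real.exp (-p * gsup N (fun k => - ∑ j ∈ Finset.range k, if hj : j < N then v ⟨j, hj⟩ else 0))
  have hF : Measurable F := by
    have : Measurable (fun v : Fin N → ℝ => gsup N (fun k => - ∑ j ∈ Finset.range k, if hj : j < N then v ⟨j, hj⟩ else 0)) := by
      unfold gsup
      have := Finset.measurable_sup' (s := Finset.range (N + 1)) Finset.nonempty_range_add_one
        (f := fun k (v : Fin N → ℝ) => - ∑ j ∈ Finset.range k, if hj : j < N then v ⟨j, hj⟩ else 0) (by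
        intro k _
        refine (Finset.measurable_sum _ fun j _ => ?_).neg
        by_cases hj : j < N
        · simp only [dif_pos hj]; exact measurable_pi_apply _
        · simp only [dif_neg hj]; exact measurable_const)
      convert this using 1
      ext v
      rw [Finset.sup'_apply]
    fun_prop
  have hm1 : Measurable (fun ω (i : Fin N) => Y (((i : ℕ) + 1 : ℝ) * h) ω - Y ((i : ℕ) * h) ω) :=
    measurable_pi_lambda _ fun i => (hY.meas _).sub (hY.meas _)
  have hm2 : Measurable (fun ω (i : Fin N) => Y (((i.rev : ℕ) + 1 : ℝ) * h) ω - Y ((i.rev : ℕ) * h) ω) :=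
    measurable_pi_lambda _ fun i => (hY.meas _).sub (hY.meas _)
  have key := congrArg (fun ν => ∫ v, F v ∂ν) (hY.rev_law hh N)
  beta_reduce at key
  rw [integral_map hm1.aemeasurable hF.aestronglyMeasurable, integral_map hm2.aemeasurable hF.aestronglyMeasurable] at key
  have e1 : ∀ ω, F (fun (i : Fin N) => Y (((i : ℕ) + 1 : ℝ) * h) ω - Y ((i : ℕ) * h) ω)
      = Real.exp (-p * gsup N (fun k => -Y (k * h) ω)) := by
    intro ω
    simp only [F]
    congr 2
    refine Finset.sup'_congr _ rfl fun k hk => ?_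
    have hk := Finset.mem_range.1 hk
    congr 1
    have := Finset.sum_range_sub (fun k : ℕ => Y (k * h) ω) k
    simp only [Nat.cast_zero, zero_mul, hY.zero, sub_zero] at this
    rw [← this]
    refine Finset.sum_congr rfl fun j hj => ?_
    have hj := Finset.mem_range.1 hj
    rw [dif_pos (by omega)]
    push_cast; rfl
  have e2 : ∀ ω, F (fun (i : Fin N) => Y (((i.rev : ℕ) + 1 : ℝ) * h) ω - Y ((i.rev : ℕ) * h) ω)
      = Real.exp (p * (Y (N * h) ω - gsup N (fun k => Y (k * h) ω))) := by
    intro ω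
    have hg := gsup_neg_rev N (fun k => Y (k * h) ω)
    simp only [F]
    rw [show p * (Y (N * h) ω - gsup N (fun k => Y (k * h) ω)) = -p * (gsup N (fun k => Y (k * h) ω) - Y (N * h) ω) by ring, ← hg]
    congr 2
    refine Finset.sup'_congr _ rfl fun k hk => ?_
    have hk := Finset.mem_range.1 hk
    congr 1
    have := Finset.sum_range_sub (fun k : ℕ => - Y ((N - k : ℕ) * h) ω) k
    simp only [Nat.sub_zero] at this
    rw [show Y (N * h) ω - Y ((N - k : ℕ) * h) ω = - Y ((N - k : ℕ) * h) ω - - Y (N * h) ω by ring, ← this]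
    refine Finset.sum_congr rfl fun j hj => ?_
    have hj := Finset.mem_range.1 hj
    rw [dif_pos (by omega)]
    simp only [Fin.val_rev]
    have h1 : (((N - (j + 1) : ℕ) : ℝ) + 1) = ((N - j : ℕ) : ℝ) := by
      have : N - (j + 1) + 1 = N - j := by omega
      exact_mod_cast this
    rw [h1]; ring
  simp_rw [e1, e2] at key
  exact key

lemma meas_gsup (hY : ∀ t, Measurable (Y t)) (h : ℝ) (N : ℕ) : Measurable (fun ω => gsup N (fun k => Y (k * h) ω)) := by
  unfold gsup
  have := Finset.measurable_sup' (s := Finset.range (N + 1)) Finset.nonempty_range_add_one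
    (f := fun k ω => Y (k * h) ω) (fun k _ => hY _)
  convert this using 1
  ext v
  rw [Finset.sup'_apply]

lemma le_gsup (N : ℕ) (v : ℕ → ℝ) {k : ℕ} (hk : k ≤ N) : v k ≤ gsup N v :=
  Finset.le_sup' v (Finset.mem_range.2 (by omega))

lemma rev (hY : LP μ Y) [IsProbabilityMeasure μ] {T p : ℝ} (hT : 0 < T) (hp : 0 ≤ p) :
    ∫ ω, Real.exp (-p * UU T (fun t => -Y t ω)) ∂μ = ∫ ω, Real.exp (p * (Y T ω - UU T (fun t => Y t ω))) ∂μ := by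
  have hNh : ∀ n : ℕ, ((n + 1 : ℕ) : ℝ) * (T / ((n : ℝ) + 1)) = T := fun n => by
    push_cast
    exact mul_div_cancel₀ _ (by positivity)
  have l1 : Tendsto (fun n : ℕ => ∫ ω, Real.exp (-p * gsup (n + 1) (fun k => -Y (k * (T / ((n : ℝ) + 1))) ω)) ∂μ) atTop
      (𝓝 (∫ ω, Real.exp (-p * UU T (fun t => -Y t ω)) ∂μ)) := by
    refine tendsto_integral_of_dominated_convergence (fun _ => 1) ?_ (integrable_const _) ?_ ?_
    · intro n
      have := meas_gsup (Y := fun t ω => - Y t ω) (fun t => (hY.meas t).neg) (T / ((n : ℝ) + 1)) (n + 1)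
      exact (by fun_prop : Measurable _).aestronglyMeasurable
    · intro n
      refine Eventually.of_forall fun ω => ?_
      rw [Real.norm_of_nonneg (by positivity), Real.exp_le_one_iff]
      have := le_gsup (n + 1) (fun k : ℕ => -Y (k * (T / ((n : ℝ) + 1))) ω) (Nat.zero_le _)
      simp [hY.zero] at this
      nlinarith
    · filter_upwards [hY.good] with ω hω
      exact (Real.continuous_exp.tendsto _).comp ((hω.1.neg.grid_sup hT).const_mul (-p))
  have l2 : Tendsto (fun n : ℕ => ∫ ω, Real.exp (-p * gsup (n + 1) (fun k => -Y (k * (T / ((n : ℝ) + 1))) ω)) ∂μ) atTop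
      (𝓝 (∫ ω, Real.exp (p * (Y T ω - UU T (fun t => Y t ω))) ∂μ)) := by
    have : ∀ n : ℕ, ∫ ω, Real.exp (-p * gsup (n + 1) (fun k => -Y (k * (T / ((n : ℝ) + 1))) ω)) ∂μ =
        ∫ ω, Real.exp (p * (Y T ω - gsup (n + 1) (fun k => Y (k * (T / ((n : ℝ) + 1))) ω))) ∂μ := by
      intro n
      rw [hY.rev_grid (h := T / ((n : ℝ) + 1)) (by positivity), hNh]
    simp_rw [this]
    refine tendsto_integral_of_dominated_convergence (fun _ => 1) ?_ (integrable_const _) ?_ ?_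
    · intro n
      have h1 := meas_gsup hY.meas (T / ((n : ℝ) + 1)) (n + 1)
      have h2 := hY.meas T
      exact (by fun_prop : Measurable _).aestronglyMeasurable
    · intro n
      refine Eventually.of_forall fun ω => ?_
      rw [Real.norm_of_nonneg (by positivity), Real.exp_le_one_iff]
      have := le_gsup (n + 1) (fun k : ℕ => Y (k * (T / ((n : ℝ) + 1))) ω) le_rfl
      simp only [hNh] at this
      nlinarith
    · filter_upwards [hY.good] with ω hω
      exact (Real.continuous_exp.tendsto _).comp (((hω.1.grid_sup hT).const_sub _).const_mul p)
  exact tendsto_nhds_unique l1 l2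

open Classical in
/-- (C) -/
lemma inf_formula (hY : LP μ Y) [IsProbabilityMeasure μ] {p c2 : ℝ} (hp : 0 < p)
    (hm : ∀ t, 0 ≤ t → lm μ Y p t = ENNReal.ofReal (Real.exp (0 * t)))
    (hm2 : ∀ t, 0 ≤ t → lm μ Y (2 * p) t = ENNReal.ofReal (Real.exp (c2 * t)))
    {T : ℝ} (hT : 0 < T) :
    ∫ ω, Real.exp (-p * UU T (fun t => -Y t ω)) ∂μ =
      1 - p * ∫ a in Ioi (0 : ℝ), ∫ ω, (if a < UU T (fun t => Y t ω) then 1 else 0) ∂μ := by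
  have hUm : Measurable (fun ω => UU T (fun t => Y t ω)) :=
    meas_UU_fix hY.meas _
  have hE := hY.int_exp hm hT.le
  simp only [zero_mul, sub_zero] at hE
  have hL := layer hE.1 hUm hp
  rw [hY.rev hT hp.le]
  have e1 : ∫ ω, Real.exp (p * (Y T ω - UU T (fun t => Y t ω))) ∂μ
      = ∫ ω, Real.exp (p * Y T ω) * Real.exp (-p * max 0 (UU T (fun t => Y t ω))) ∂μ := by
    refine integral_congr_ae ?_
    filter_upwards [hY.good] with ω hω
    have h0 : 0 ≤ UU T (fun t => Y t ω) := by
      have := (hω.1.isLUB hT.le).1 ⟨0, ⟨le_rfl, hT.le⟩, rfl⟩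
      simpa [hY.zero] using this
    rw [max_eq_right h0, ← Real.exp_add]
    congr 1; ring
  rw [e1, hL, hE.2, ← integral_const_mul]
  congr 1
  refine setIntegral_congr_fun measurableSet_Ioi fun a ha => ?_
  have ha : 0 < a := ha
  have hf := hY.fpt le_rfl hm hm2 ha hT
  simp only [zero_mul, sub_zero] at hf
  have g1 : ∫ ω, (if a < UU T (fun t => Y t ω) then Real.exp (p * Y T ω) else 0) ∂μ =
      ∫ ω, (if ∃ s ∈ Icc 0 T, a < Y s ω then Real.exp (p * Y T ω) else 0) ∂μ := by
    refine integral_congr_ae ?_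
    filter_upwards [hY.good] with ω hω
    simp only [hω.1.lt_UU hT.le]
  have g2 : ∫ ω, (if ∃ s ∈ Icc 0 T, a < Y s ω then Real.exp (p * a) else 0) ∂μ =
      ∫ ω, Real.exp (p * a) * (if a < UU T (fun t => Y t ω) then 1 else 0) ∂μ := by
    refine integral_congr_ae ?_
    filter_upwards [hY.good] with ω hω
    simp only [hω.1.lt_UU hT.le]
    split_ifs <;> simp
  rw [g1, hf, g2, integral_const_mul, ← mul_assoc, mul_assoc p, ← Real.exp_add]
  simp

open Classical in
/-- (B) -/
lemma tail_q (hY : LP μ Y) [IsProbabilityMeasure μ] {θ c c2 : ℝ} (hθ : 0 ≤ θ) (hc : 0 < c)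
    (hm : ∀ t, 0 ≤ t → lm μ Y θ t = ENNReal.ofReal (Real.exp (c * t)))
    (hm2 : ∀ t, 0 ≤ t → lm μ Y (2 * θ) t = ENNReal.ofReal (Real.exp (c2 * t)))
    {a : ℝ} (ha : 0 < a) :
    AEMeasurable (fun ω => if ∃ s, 0 ≤ s ∧ a < Y s ω then Real.exp (- c * tau a (fun t => Y t ω)) else 0) μ ∧
    ∫ ω, (if ∃ s, 0 ≤ s ∧ a < Y s ω then Real.exp (- c * tau a (fun t => Y t ω)) else 0) ∂μ = Real.exp (-θ * a) := by
  let F : ℕ → Ω → ℝ := fun n ω => if ∃ s ∈ Icc 0 ((n : ℝ) + 1), a < Y s ω then Real.exp (- c * tau a (fun t => Y t ω)) else 0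
  have hFm : ∀ n, AEMeasurable (F n) μ := by
    intro n
    refine aemeasurable_of_tendsto_metrizable_ae atTop (f := fun m : ℕ => SV Y a (((n : ℝ) + 1) / ((m : ℝ) + 1)) 0 c (m + 1))
      (fun m => (hY.meas_SV _ _ _ _ _).aemeasurable) ?_
    filter_upwards [hY.good] with ω hω
    have := hω.grid_fp (T := (n : ℝ) + 1) (by positivity) ha (g := fun z => Real.exp (0 * z.2 - c * z.1)) (by fun_prop)
    simp only [zero_mul, zero_sub] at this
    simp only [F, SV, zero_mul, zero_sub, neg_mul]
    exact this
  have hlim : ∀ ω, Tendsto (fun n => F n ω) atTop (𝓝 (if ∃ s, 0 ≤ s ∧ a < Y s ω then Real.exp (- c * tau a (fun t => Y t ω)) else 0)) := by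
    intro ω
    by_cases hA : ∃ s, 0 ≤ s ∧ a < Y s ω
    · rw [if_pos hA]
      obtain ⟨s, hs, has⟩ := hA
      refine tendsto_const_nhds.congr' ?_
      obtain ⟨N, hN⟩ := exists_nat_ge s
      filter_upwards [eventually_ge_atTop N] with n hn
      simp only [F]
      rw [if_pos]
      refine ⟨s, ⟨hs, ?_⟩, has⟩
      have : (N : ℝ) ≤ n := by exact_mod_cast hn
      linarith
    · rw [if_neg hA]
      refine tendsto_const_nhds.congr fun n => ?_
      simp only [F]
      rw [if_neg]
      rintro ⟨s, hs, has⟩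
      exact hA ⟨s, hs.1, has⟩
  refine ⟨aemeasurable_of_tendsto_metrizable_ae atTop hFm (Eventually.of_forall hlim), ?_⟩
  have l1 : Tendsto (fun n => ∫ ω, F n ω ∂μ) atTop (𝓝 (∫ ω, (if ∃ s, 0 ≤ s ∧ a < Y s ω then Real.exp (- c * tau a (fun t => Y t ω)) else 0) ∂μ)) := by
    refine tendsto_integral_of_dominated_convergence (fun _ => 1) (fun n => (hFm n).aestronglyMeasurable)
      (integrable_const _) ?_ (Eventually.of_forall hlim)
    intro n
    filter_upwards [hY.good] with ω hω
    simp only [F]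
    split_ifs with hA
    · obtain ⟨s, hs, has⟩ := hA
      have := (hω.f_tau ha ⟨s, hs.1, has⟩).1
      rw [Real.norm_of_nonneg (by positivity), Real.exp_le_one_iff]
      nlinarith
    · simp
  have hFe : ∀ n : ℕ, ∫ ω, F n ω ∂μ = Real.exp (-θ * a) * ∫ ω, (if ∃ s ∈ Icc 0 ((n : ℝ) + 1), a < Y s ω then
      Real.exp (θ * Y ((n : ℝ) + 1) ω - c * ((n : ℝ) + 1)) else 0) ∂μ := by
    intro n
    rw [hY.fpt hc.le hm hm2 ha (by positivity), ← integral_const_mul]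
    congr 1; ext ω
    simp only [F]
    split_ifs
    · rw [← Real.exp_add]; congr 1; ring
    · simp
  have hup : ∀ n : ℕ, ∫ ω, F n ω ∂μ ≤ Real.exp (-θ * a) ∧
      Real.exp (-θ * a) - Real.exp (-c * ((n : ℝ) + 1)) ≤ ∫ ω, F n ω ∂μ := by
    intro n
    have hE := hY.int_exp hm (show 0 ≤ (n : ℝ) + 1 by positivity)
    rw [hFe]
    have hUm : Measurable (fun ω => UU ((n : ℝ) + 1) (fun t => Y t ω)) :=
      meas_UU_fix hY.meas _
    have hI : Integrable (fun ω => if ∃ s ∈ Icc 0 ((n : ℝ) + 1), a < Y s ω then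
      Real.exp (θ * Y ((n : ℝ) + 1) ω - c * ((n : ℝ) + 1)) else 0) μ := by
      refine hE.1.mono ?_ (Eventually.of_forall fun ω => ?_)
      · have h1 : Measurable (fun ω => if a < UU ((n : ℝ) + 1) (fun t => Y t ω) then
          Real.exp (θ * Y ((n : ℝ) + 1) ω - c * ((n : ℝ) + 1)) else 0) := by
          refine Measurable.ite (measurableSet_lt measurable_const hUm) ?_ measurable_const
          have := hY.meas ((n : ℝ) + 1)
          fun_prop
        refine h1.aestronglyMeasurable.congr ?_
        filter_upwards [hY.good] with ω hω
        simp only [hω.1.lt_UU (show 0 ≤ (n : ℝ) + 1 by positivity)]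
      · split_ifs <;> simp [Real.exp_nonneg]
    constructor
    · refine mul_le_of_le_one_right (by positivity) ?_
      refine le_of_le_of_eq ?_ hE.2
      refine integral_mono hI hE.1 fun ω => ?_
      simp only
      split_ifs
      · exact le_rfl
      · positivity
    · have : 1 - Real.exp (θ * a - c * ((n : ℝ) + 1)) ≤ ∫ ω, (if ∃ s ∈ Icc 0 ((n : ℝ) + 1), a < Y s ω then
        Real.exp (θ * Y ((n : ℝ) + 1) ω - c * ((n : ℝ) + 1)) else 0) ∂μ := by
        have e : ∫ ω, (Real.exp (θ * Y ((n : ℝ) + 1) ω - c * ((n : ℝ) + 1)) - Real.exp (θ * a - c * ((n : ℝ) + 1))) ∂μ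
          = 1 - Real.exp (θ * a - c * ((n : ℝ) + 1)) := by
          rw [integral_sub hE.1 (integrable_const _), hE.2]; simp
        rw [← e]
        refine integral_mono (hE.1.sub (integrable_const _)) hI fun ω => ?_
        simp only
        split_ifs with hA
        · linarith [Real.exp_pos (θ * a - c * ((n : ℝ) + 1))]
        · push Not at hA
          have := hA ((n : ℝ) + 1) ⟨by positivity, le_rfl⟩
          rw [sub_nonpos]
          apply Real.exp_le_exp.2
          nlinarith
      calc Real.exp (-θ * a) - Real.exp (-c * ((n : ℝ) + 1)) = Real.exp (-θ * a) * (1 - Real.exp (θ * a - c * ((n : ℝ) + 1))) := by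
            rw [mul_sub, mul_one, ← Real.exp_add]; congr 2; ring
        _ ≤ _ := by gcongr
  have l2 : Tendsto (fun n => ∫ ω, F n ω ∂μ) atTop (𝓝 (Real.exp (-θ * a))) := by
    refine tendsto_of_tendsto_of_tendsto_of_le_of_le ?_ tendsto_const_nhds (fun n => (hup n).2) (fun n => (hup n).1)
    have h1 : Tendsto (fun n : ℕ => (n : ℝ) + 1) atTop atTop :=
      tendsto_atTop_add_const_right _ _ tendsto_natCast_atTop_atTop
    have h2 := Real.tendsto_exp_atBot.comp (h1.const_mul_atTop_of_neg (show -c < 0 by linarith))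
    have := h2.const_sub (Real.exp (-θ * a))
    rw [sub_zero] at this
    exact this
  exact tendsto_nhds_unique l1 l2

open Classical in
/-- (A) -/
lemma tail_0 (hY : LP μ Y) [IsProbabilityMeasure μ] {p : ℝ} {θ c c2 : ℕ → ℝ} (hθ : ∀ n, 0 ≤ θ n) (hc : ∀ n, 0 < c n)
    (hm : ∀ n t, 0 ≤ t → lm μ Y (θ n) t = ENNReal.ofReal (Real.exp (c n * t)))
    (hm2 : ∀ n t, 0 ≤ t → lm μ Y (2 * θ n) t = ENNReal.ofReal (Real.exp (c2 n * t)))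
    (hθp : Tendsto θ atTop (𝓝 p)) (hc0 : Tendsto c atTop (𝓝 0)) {a : ℝ} (ha : 0 < a) :
    ∫ ω, (if ∃ s, 0 ≤ s ∧ a < Y s ω then 1 else 0) ∂μ = Real.exp (-p * a) := by
  have l1 : Tendsto (fun n => ∫ ω, (if ∃ s, 0 ≤ s ∧ a < Y s ω then Real.exp (- c n * tau a (fun t => Y t ω)) else 0) ∂μ)
      atTop (𝓝 (∫ ω, (if ∃ s, 0 ≤ s ∧ a < Y s ω then 1 else 0) ∂μ)) := by
    refine tendsto_integral_of_dominated_convergence (fun _ => 1)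
      (fun n => (hY.tail_q (hθ n) (hc n) (hm n) (hm2 n) ha).1.aestronglyMeasurable) (integrable_const _) ?_ ?_
    · intro n
      filter_upwards [hY.good] with ω hω
      split_ifs with hA
      · have := (hω.f_tau ha hA).1
        rw [Real.norm_of_nonneg (by positivity), Real.exp_le_one_iff]
        nlinarith [hc n]
      · simp
    · refine Eventually.of_forall fun ω => ?_
      split_ifs with hA
      · have := (Real.continuous_exp.tendsto _).comp (hc0.neg.mul_const (tau a (fun t => Y t ω)))
        simpa [Function.comp_def] using this
      · exact tendsto_const_nhds
  have l2 : Tendsto (fun n => Real.exp (-θ n * a)) atTop (𝓝 (Real.exp (-p * a))) :=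
    (Real.continuous_exp.tendsto _).comp (hθp.neg.mul_const a)
  refine tendsto_nhds_unique l1 (l2.congr fun n => ?_)
  exact (hY.tail_q (hθ n) (hc n) (hm n) (hm2 n) ha).2.symm

end LP

lemma phi_facts {m ψ Φ : ℝ → ℝ} (hconv : ConvexOn ℝ (Ici 0) m) (hm0 : m 0 = 1) (hpos : ∀ θ, 0 ≤ θ → 0 < m θ)
    (hψ : ∀ θ, ψ θ = Real.log (m θ)) (hΦ : ∀ q : ℝ, Φ q = sSup {θ : ℝ | 0 ≤ θ ∧ ψ θ = q}) (hΦ0 : 0 < Φ 0) :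
    ψ (Φ 0) = 0 ∧ (∀ q, 0 < q → Φ 0 < Φ q ∧ ψ (Φ q) = q) ∧
    Tendsto (fun n : ℕ => Φ (1 / ((n : ℝ) + 1))) atTop (𝓝 (Φ 0)) := by
  set p := Φ 0 with hp
  have hm : ∀ θ, 0 ≤ θ → ∀ q, ψ θ = q ↔ m θ = Real.exp q := by
    intro θ hθ q
    rw [hψ]
    constructor
    · rintro rfl; rw [Real.exp_log (hpos θ hθ)]
    · intro h; rw [h, Real.log_exp]
  have hcont : ∀ θ, 0 < θ → ContinuousAt m θ := by
    intro θ hθ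
    have h1 := hconv.continuousOn_interior
    rw [interior_Ici] at h1
    exact h1.continuousAt (Ioi_mem_nhds hθ)
  let Z := {θ : ℝ | 0 ≤ θ ∧ ψ θ = 0}
  have hpZ : p = sSup Z := hΦ 0
  have hZb : BddAbove Z := by
    by_contra h
    rw [Real.sSup_of_not_bddAbove h] at hpZ
    linarith
  have hZn : Z.Nonempty := ⟨0, le_rfl, by rw [hm 0 le_rfl, hm0, Real.exp_zero]⟩
  have hmp : m p = 1 := by
    obtain ⟨u, -, hu, huZ⟩ := exists_seq_tendsto_sSup hZn hZb
    rw [← hpZ] at hu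
    have h1 := (hcont p hΦ0).tendsto.comp hu
    refine tendsto_nhds_unique h1 (tendsto_const_nhds.congr fun n => ?_)
    have := (hm _ (huZ n).1 0).1 (huZ n).2
    rw [Real.exp_zero] at this
    exact this.symm
  have hcx : ∀ s t, 0 ≤ s → 0 < t → s ≤ t → m s - 1 ≤ (s / t) * (m t - 1) := by
    intro s t hs ht hst
    have h1 : s / t ≤ 1 := (div_le_one ht).2 hst
    have := hconv.2 (show (0 : ℝ) ∈ Ici (0 : ℝ) from mem_Ici.2 le_rfl) (show t ∈ Ici 0 from ht.le) (show 0 ≤ 1 - s / t by linarith)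
      (show 0 ≤ s / t by positivity) (by ring)
    simp only [smul_eq_mul, mul_zero, zero_add, hm0] at this
    rw [div_mul_cancel₀ _ ht.ne'] at this
    linarith
  have hgt : ∀ θ, p < θ → 1 < m θ := by
    intro θ hθ
    have h1 := hcx p θ hΦ0.le (hΦ0.trans hθ) hθ.le
    rw [hmp, sub_self] at h1
    have h2 : 0 < p / θ := div_pos hΦ0 (hΦ0.trans hθ)
    have h3 : 0 ≤ m θ - 1 := nonneg_of_mul_nonneg_right h1 h2
    rcases h3.eq_or_lt with h | h
    · exfalso
      have : θ ∈ Z := ⟨(hΦ0.trans hθ).le, by rw [hm _ (hΦ0.trans hθ).le, Real.exp_zero]; linarith⟩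
      have := le_csSup hZb this
      rw [← hpZ] at this
      linarith
    · linarith
  have hmono : ∀ s t, p < s → s < t → m s < m t := by
    intro s t hs hst
    have h1 := hcx s t (by linarith) (by linarith) hst.le
    have h2 : s / t < 1 := (div_lt_one (by linarith)).2 hst
    have h3 := hgt t (by linarith)
    nlinarith
  have hle : ∀ θ, 0 ≤ θ → θ ≤ p → m θ ≤ 1 := by
    intro θ h0 h1
    have := hcx θ p h0 hΦ0 h1
    rw [hmp] at this
    linarith
  have hlt : ∀ θ, 0 ≤ θ → 1 < m θ → p < θ := by
    intro θ h0 h1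
    by_contra h
    linarith [hle θ h0 (not_lt.1 h)]
  have hex : ∀ q, 0 < q → Φ 0 < Φ q ∧ ψ (Φ q) = q := by
    intro q hq
    have hq1 : 1 < Real.exp q := Real.one_lt_exp_iff.2 hq
    have hd := hgt (p + 1) (by linarith)
    set d := m (p + 1) - 1 with hdd
    have hd0 : 0 < d := by linarith
    set t := max (p + 1) ((p + 1) * Real.exp q / d) with htt
    have ht1 : p + 1 ≤ t := le_max_left _ _
    have ht2 : (p + 1) * Real.exp q / d ≤ t := le_max_right _ _
    have h1 := hcx (p + 1) t (by linarith) (by linarith) ht1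
    have h2 : Real.exp q ≤ m t := by
      rw [div_le_iff₀ hd0] at ht2
      have h3 : m t - 1 ≥ t / (p + 1) * d := by
        have : 0 < t := by linarith
        rw [div_mul_eq_mul_div, le_div_iff₀ this] at h1
        rw [ge_iff_le, div_mul_eq_mul_div, div_le_iff₀ (by linarith)]
        linarith
      have h4 : Real.exp q ≤ t / (p + 1) * d := by
        rw [div_mul_eq_mul_div, le_div_iff₀ (by linarith)]
        linarith
      linarith
    have hc : ContinuousOn m (Icc p t) := fun θ hθ => (hcont θ (by linarith [hθ.1])).continuousWithinAt
    obtain ⟨r, hr, hrq⟩ := intermediate_value_Icc (by linarith) hc (show Real.exp q ∈ Icc (m p) (m t) from ⟨by rw [hmp]; exact hq1.le, h2⟩)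
    have hr0 : 0 ≤ r := by linarith [hr.1]
    have hrp := hlt r hr0 (by rw [hrq]; exact hq1)
    have hset : {θ : ℝ | 0 ≤ θ ∧ ψ θ = q} = {r} := by
      ext θ
      simp only [mem_ofPred_eq, mem_singleton_iff]
      constructor
      · rintro ⟨h0, h⟩
        rw [hm θ h0] at h
        have := hlt θ h0 (by rw [h]; exact hq1)
        rcases lt_trichotomy θ r with h' | h' | h'
        · linarith [hmono _ _ this h']
        · exact h'
        · linarith [hmono _ _ hrp h']
      · rintro rfl
        exact ⟨hr0, (hm _ hr0 _).2 hrq⟩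
    have : Φ q = r := by rw [hΦ, hset, csSup_singleton]
    rw [this]
    exact ⟨hrp, (hm _ hr0 _).2 hrq⟩
  refine ⟨by rw [hψ, hmp, Real.log_one], hex, ?_⟩
  rw [tendsto_order]
  have hn : ∀ n : ℕ, (0 : ℝ) < 1 / ((n : ℝ) + 1) := fun n => by positivity
  constructor
  · intro b hb
    exact Eventually.of_forall fun n => hb.trans (hex _ (hn n)).1
  · intro b hb
    have hb1 := hgt b hb
    have : 0 < Real.log (m b) := Real.log_pos hb1
    filter_upwards [(tendsto_one_div_add_atTop_nhds_zero_nat (𝕜 := ℝ)).eventually_lt_const this] with n hnn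
    obtain ⟨h1, h2⟩ := hex _ (hn n)
    by_contra hcon
    have hcon := not_lt.1 hcon
    have h3 : m b ≤ m (Φ (1 / ((n : ℝ) + 1))) := by
      rcases hcon.eq_or_lt with h | h
      · rw [← h]
      · exact (hmono _ _ hb h).le
    have h4 := Real.log_le_log (by linarith) h3
    rw [← hψ, ← hψ, h2, hψ] at h4
    linarith

lemma mgf_convex {Ω : Type*} [MeasurableSpace Ω] {μ : Measure Ω} {V : Ω → ℝ}
    (h : ∀ θ : ℝ, 0 ≤ θ → Integrable (fun ω => Real.exp (θ * V ω)) μ) :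
    ConvexOn ℝ (Ici 0) (fun θ => ∫ ω, Real.exp (θ * V ω) ∂μ) := by
  refine ⟨convex_Ici 0, fun s hs t ht a b ha hb hab => ?_⟩
  have hs : 0 ≤ s := hs
  have ht : 0 ≤ t := ht
  simp only [smul_eq_mul]
  rw [← integral_const_mul, ← integral_const_mul, ← integral_add ((h s hs).const_mul a) ((h t ht).const_mul b)]
  refine integral_mono (h _ (by positivity)) (((h s hs).const_mul a).add ((h t ht).const_mul b)) fun ω => ?_
  have := convexOn_exp.2 (mem_univ (s * V ω)) (mem_univ (t * V ω)) ha hb hab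
  simp only [smul_eq_mul] at this
  simp only
  rw [show (a * s + b * t) * V ω = a * (s * V ω) + b * (t * V ω) by ring]
  exact this

lemma indep_integral {Ω α β : Type*} [MeasurableSpace Ω] [MeasurableSpace α] [MeasurableSpace β]
    {μ : Measure Ω} [IsProbabilityMeasure μ] {U : Ω → α} {W : Ω → β} (hU : Measurable U) (hW : Measurable W)
    (h : IndepFun U W μ) {G : α × β → ℝ} (hG : Measurable G) (hb : ∀ z, ‖G z‖ ≤ 1) :
    ∫ ω, G (U ω, W ω) ∂μ = ∫ t, ∫ ω, G (t, W ω) ∂μ ∂(μ.map U) := by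
  have := Measure.isProbabilityMeasure_map (μ := μ) hU.aemeasurable
  have := Measure.isProbabilityMeasure_map (μ := μ) hW.aemeasurable
  have h1 : ∫ ω, G (U ω, W ω) ∂μ = ∫ z, G z ∂(μ.map (fun ω => (U ω, W ω))) := by
    rw [integral_map (hU.prodMk hW).aemeasurable hG.aestronglyMeasurable]
  rw [h1, (indepFun_iff_map_prod_eq_prod_map_map hU.aemeasurable hW.aemeasurable).1 h, integral_prod]
  · refine integral_congr_ae (Eventually.of_forall fun t => ?_)
    exact integral_map (f := fun w => G (t, w)) hW.aemeasurable (hG.comp measurable_prodMk_left).aestronglyMeasurable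
  · exact Integrable.of_bound hG.aestronglyMeasurable 1 (Eventually.of_forall hb)

lemma tonelli {Ω : Type*} [MeasurableSpace Ω] {μ : Measure Ω} [IsProbabilityMeasure μ] {V : ℝ → Ω → ℝ}
    (hV : Measurable (fun z : ℝ × Ω => V z.1 z.2)) (ν : Measure ℝ) [IsProbabilityMeasure ν] :
    ∫⁻ t, (∫⁻ a in Ioi (0 : ℝ), ∫⁻ ω, (if a < V t ω then (1 : ENNReal) else 0) ∂μ) ∂ν =
    ∫⁻ a in Ioi (0 : ℝ), ∫⁻ ω, ν {t | a < V t ω} ∂μ := by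
  have h3 : Measurable (fun z : (ℝ × ℝ) × Ω => (if z.1.2 < V z.1.1 z.2 then (1 : ENNReal) else 0)) := by
    refine Measurable.ite ?_ measurable_const measurable_const
    refine measurableSet_lt (by fun_prop) ?_
    exact hV.comp (g := fun z : ℝ × Ω => V z.1 z.2) (f := fun z : (ℝ × ℝ) × Ω => (z.1.1, z.2)) (by fun_prop)
  have h2 : Measurable (fun z : ℝ × ℝ => ∫⁻ ω, (if z.2 < V z.1 ω then (1 : ENNReal) else 0) ∂μ) :=
    Measurable.lintegral_prod_right' h3
  rw [lintegral_lintegral_swap h2.aemeasurable]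
  apply lintegral_congr
  intro a
  have h4 : Measurable (fun z : ℝ × Ω => (if a < V z.1 z.2 then (1 : ENNReal) else 0)) :=
    Measurable.ite (measurableSet_lt measurable_const hV) measurable_const measurable_const
  rw [lintegral_lintegral_swap h4.aemeasurable]
  refine lintegral_congr fun ω => ?_
  have h5 : MeasurableSet {t | a < V t ω} :=
    measurableSet_lt measurable_const (hV.comp (g := fun z : ℝ × Ω => V z.1 z.2) (f := fun t => (t, ω)) (by fun_prop))
  rw [← lintegral_indicator_one h5]
  refine lintegral_congr fun t => ?_
  simp [indicator_apply]

open Classical in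
lemma path_law {ν : Measure ℝ} [IsProbabilityMeasure ν] {q : ℝ}
    (hν : ∀ y : ℝ, 0 ≤ y → ν (Ioi y) = ENNReal.ofReal (Real.exp (-(q * y)))) {f : ℝ → ℝ} (hf : Good f) {a : ℝ} (ha : 0 < a) :
    ν {t | a < UU t f} = ENNReal.ofReal (if ∃ s, 0 ≤ s ∧ a < f s then Real.exp (-q * tau a f) else 0) := by
  have h0 : ν (Iic 0) = 0 := by
    have h1 : ν (Ioi 0) = 1 := by rw [hν 0 le_rfl]; simp
    have := prob_compl_eq_zero_iff (μ := ν) (measurableSet_Ioi (a := (0 : ℝ)))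
    rw [compl_Ioi] at this
    exact this.2 h1
  have hsub : ∀ S : Set ℝ, {t | a < UU t f} ∩ Ioi 0 ⊆ S → ν {t | a < UU t f} ≤ ν S := by
    intro S hS
    calc ν {t | a < UU t f} ≤ ν (S ∪ Iic 0) := by
          apply measure_mono
          intro t ht
          rcases lt_or_ge 0 t with h | h
          · exact Or.inl (hS ⟨ht, h⟩)
          · exact Or.inr h
      _ ≤ ν S + ν (Iic 0) := measure_union_le _ _
      _ = ν S := by rw [h0, add_zero]
  split_ifs with hA
  · have hne : {s | 0 ≤ s ∧ a < f s}.Nonempty := hA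
    have ht := (hf.f_tau ha hA).1
    apply le_antisymm
    · have hseq : Tendsto (fun n : ℕ => ENNReal.ofReal (Real.exp (-(q * (tau a f * (1 - 1 / ((n : ℝ) + 1))))))) atTop
          (𝓝 (ENNReal.ofReal (Real.exp (-q * tau a f)))) := by
        refine ENNReal.tendsto_ofReal ?_
        have h1 := (tendsto_one_div_add_atTop_nhds_zero_nat (𝕜 := ℝ)).const_sub 1
        have h2 := ((h1.const_mul (tau a f)).const_mul q).neg
        have h3 := (Real.continuous_exp.tendsto _).comp h2
        simp only [sub_zero, mul_one] at h3
        rw [neg_mul]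
        exact h3
      refine ge_of_tendsto' hseq fun n => ?_
      have hn : (0 : ℝ) < 1 / ((n : ℝ) + 1) := by positivity
      have hn1 : 1 / ((n : ℝ) + 1) ≤ 1 := by
        rw [div_le_one (by positivity)]; linarith [Nat.cast_nonneg (α := ℝ) n]
      rw [← hν _ (mul_nonneg ht.le (by linarith))]
      apply hsub
      rintro t ⟨h1, h2⟩
      have h2 : 0 < t := h2
      obtain ⟨s, hs, has⟩ := (hf.1.lt_UU h2.le).1 h1
      have := tau_le hs.1 has
      have h3 := hs.2
      show tau a f * (1 - 1 / ((n : ℝ) + 1)) < t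
      nlinarith
    · rw [neg_mul, ← hν _ ht.le]
      apply measure_mono
      intro t htt
      have htt : tau a f < t := htt
      obtain ⟨s, hs, hst⟩ := exists_lt_of_csInf_lt hne htt
      exact (hf.1.lt_UU (ht.trans htt).le).2 ⟨s, ⟨hs.1, hst.le⟩, hs.2⟩
  · have := hsub ∅ (by
      rintro t ⟨h1, h2⟩
      have h2 : 0 < t := h2
      obtain ⟨s, hs, has⟩ := (hf.1.lt_UU h2.le).1 h1
      exact hA ⟨s, hs.1, has⟩)
    simpa using this

namespace LP
variable {Ω : Type*} [MeasurableSpace Ω] {μ : Measure Ω} {Y : ℝ → Ω → ℝ}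

open Classical in
lemma Q_tail (hY : LP μ Y) [IsProbabilityMeasure μ] {p : ℝ} (hp : 0 < p)
    (hA : ∀ a, 0 < a → ∫ ω, (if ∃ s, 0 ≤ s ∧ a < Y s ω then (1 : ℝ) else 0) ∂μ = Real.exp (-p * a))
    {Q : Ω → ℝ} (hQ : Measurable Q)
    (hd : μ.map Q = μ.map (fun ω => ⨆ r : {r : ℝ // 0 ≤ r}, Y (r : ℝ) ω)) {u : ℝ} (hu : 0 < u) :
    ∫ ω, (if u < Q ω then (1 : ℝ) else 0) ∂μ = Real.exp (-p * u) := by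
  have hQp := Measure.isProbabilityMeasure_map (μ := μ) hQ.aemeasurable
  have hS : AEMeasurable (fun ω => ⨆ r : {r : ℝ // 0 ≤ r}, Y (r : ℝ) ω) μ := by
    by_contra h
    rw [Measure.map_of_not_aemeasurable h] at hd
    have := hQp.measure_univ
    rw [hd] at this
    simp at this
  let M : ℝ → Set Ω := fun a => ⋃ n : ℕ, {ω | a < UU n (fun t => Y t ω)}
  have hMm : ∀ a, MeasurableSet (M a) := fun a =>
    MeasurableSet.iUnion fun n => measurableSet_lt measurable_const (meas_UU_fix hY.meas _)
  have hM : ∀ᵐ ω ∂μ, ∀ a, ω ∈ M a ↔ ∃ s, 0 ≤ s ∧ a < Y s ω := by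
    filter_upwards [hY.good] with ω hω a
    simp only [M, mem_iUnion]
    constructor
    · rintro ⟨n, hn⟩
      obtain ⟨s, hs, has⟩ := (hω.1.lt_UU (Nat.cast_nonneg n)).1 hn
      exact ⟨s, hs.1, has⟩
    · rintro ⟨s, hs, has⟩
      obtain ⟨n, hn⟩ := exists_nat_ge s
      exact ⟨n, (hω.1.lt_UU (Nat.cast_nonneg n)).2 ⟨s, ⟨hs, hn⟩, has⟩⟩
  have hMμ : ∀ a, 0 < a → μ.real (M a) = Real.exp (-p * a) := by
    intro a ha
    rw [← hA a ha, ← integral_indicator_one (hMm a)]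
    refine integral_congr_ae ?_
    filter_upwards [hM] with ω hω
    simp only [indicator_apply, hω a, Pi.one_apply]
  have hbdd : ∀ᵐ ω ∂μ, BddAbove (range fun r : {r : ℝ // 0 ≤ r} => Y (r : ℝ) ω) := by
    have h0 : μ (⋂ n : ℕ, M ((n : ℝ) + 1)) = 0 := by
      rw [← measureReal_eq_zero_iff]
      refine le_antisymm ?_ measureReal_nonneg
      have h1 : Tendsto (fun n : ℕ => (n : ℝ) + 1) atTop atTop :=
        tendsto_atTop_add_const_right _ _ tendsto_natCast_atTop_atTop
      have h2 := Real.tendsto_exp_atBot.comp (h1.const_mul_atTop_of_neg (show -p < 0 by linarith))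
      refine ge_of_tendsto' h2 fun n => ?_
      simp only [Function.comp]
      rw [← hMμ _ (by positivity)]
      exact measureReal_mono (iInter_subset _ n)
    have h1 : ∀ᵐ ω ∂μ, ω ∉ ⋂ n : ℕ, M ((n : ℝ) + 1) := compl_mem_ae_iff.2 h0
    filter_upwards [h1, hM] with ω h1 hM
    simp only [mem_iInter, not_forall] at h1
    obtain ⟨n, hn⟩ := h1
    rw [hM] at hn
    push Not at hn
    refine ⟨(n : ℝ) + 1, ?_⟩
    rintro _ ⟨r, rfl⟩
    exact hn r r.2
  have hmi : Measurable (fun z : ℝ => if u < z then (1 : ℝ) else 0) :=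
    Measurable.ite measurableSet_Ioi measurable_const measurable_const
  have e1 : ∫ ω, (if u < Q ω then (1 : ℝ) else 0) ∂μ = ∫ z, (if u < z then (1 : ℝ) else 0) ∂(μ.map Q) := by
    rw [integral_map hQ.aemeasurable hmi.aestronglyMeasurable]
  rw [e1, hd, integral_map hS hmi.aestronglyMeasurable, ← hA u hu]
  refine integral_congr_ae ?_
  filter_upwards [hbdd] with ω hb
  have hiff : (u < ⨆ r : {r : ℝ // 0 ≤ r}, Y (r : ℝ) ω) ↔ ∃ s, 0 ≤ s ∧ u < Y s ω := by
    have : Nonempty {r : ℝ // 0 ≤ r} := ⟨0, le_rfl⟩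
    rw [lt_ciSup_iff hb]
    simp
  simp only [hiff]

/-- workload transform at fixed shift -/
lemma Q_shift [IsProbabilityMeasure μ] {p x : ℝ} (hp : 0 < p) (hx : 0 < x) {Q : Ω → ℝ} (hQ : Measurable Q)
    (hT : ∀ u, 0 < u → ∫ ω, (if u < Q ω then (1 : ℝ) else 0) ∂μ = Real.exp (-p * u)) {i : ℝ} (hi : 0 ≤ i) :
    ∫ ω, Real.exp (-x * max 0 (Q ω - i)) ∂μ = 1 - x / (x + p) * Real.exp (-p * i) := by
  have hL := layer (μ := μ) (W := fun _ => 1) (Z := fun ω => Q ω - i) (integrable_const _) (by fun_prop) hx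
  simp only [one_mul] at hL
  rw [hL]
  have : ∫ u in Ioi (0 : ℝ), x * Real.exp (-x * u) * ∫ ω, (if u < Q ω - i then (1 : ℝ) else 0) ∂μ
      = ∫ u in Ioi (0 : ℝ), (x * Real.exp (-p * i)) * Real.exp (-(x + p) * u) := by
    refine setIntegral_congr_fun measurableSet_Ioi fun u hu => ?_
    have hu : 0 < u := hu
    have := hT (u + i) (by linarith)
    simp only [lt_sub_iff_add_lt, this]
    rw [mul_assoc, mul_assoc, ← Real.exp_add, ← Real.exp_add]
    congr 2; ring
  rw [this, integral_const_mul, integral_exp_Ioi (by linarith)]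
  simp
  ring

end LP

namespace LP
variable {Ω : Type*} [MeasurableSpace Ω] {μ : Measure Ω} {Y : ℝ → Ω → ℝ}

lemma H_int (hY : LP μ Y) [IsProbabilityMeasure μ] {q φ c2 : ℝ} (hq : 0 < q) (hφ : 0 < φ)
    (hm : ∀ t, 0 ≤ t → lm μ Y φ t = ENNReal.ofReal (Real.exp (q * t)))
    (hm2 : ∀ t, 0 ≤ t → lm μ Y (2 * φ) t = ENNReal.ofReal (Real.exp (c2 * t)))
    {ν : Measure ℝ} [IsProbabilityMeasure ν]
    (hν : ∀ y : ℝ, 0 ≤ y → ν (Ioi y) = ENNReal.ofReal (Real.exp (-(q * y)))) :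
    Integrable (fun t => ∫ a in Ioi (0 : ℝ), ∫ ω, (if a < UU t (fun s => Y s ω) then (1 : ℝ) else 0) ∂μ) ν ∧
    ∫ t, (∫ a in Ioi (0 : ℝ), ∫ ω, (if a < UU t (fun s => Y s ω) then (1 : ℝ) else 0) ∂μ) ∂ν = 1 / φ := by
  classical
  obtain ⟨V, hVd⟩ : ∃ V : ℝ → Ω → ℝ, V = fun t ω => UU t (fun s => Y s ω) := ⟨_, rfl⟩
  have hVd' : ∀ t ω, UU t (fun s => Y s ω) = V t ω := fun t ω => by rw [hVd]
  have hV : Measurable (fun z : ℝ × Ω => V z.1 z.2) := by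
    rw [hVd]; exact meas_UU_comp hY.meas
  simp only [hVd']
  have hV1 : ∀ t, Measurable (V t) := fun t => by rw [hVd]; exact meas_UU_fix hY.meas t
  let J : ℝ → ENNReal := fun t => ∫⁻ a in Ioi (0 : ℝ), ∫⁻ ω, (if a < V t ω then (1 : ENNReal) else 0) ∂μ
  have hset : ∀ t a, MeasurableSet {ω | a < V t ω} := fun t a => measurableSet_lt measurable_const (hV1 t)
  have hin : ∀ t a, ∫⁻ ω, (if a < V t ω then (1 : ENNReal) else 0) ∂μ = μ {ω | a < V t ω} := by
    intro t a
    rw [← lintegral_indicator_one (hset t a)]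
    refine lintegral_congr fun ω => ?_
    simp [indicator_apply]
  have hre : ∀ t a, ∫ ω, (if a < V t ω then (1 : ℝ) else 0) ∂μ = (∫⁻ ω, (if a < V t ω then (1 : ENNReal) else 0) ∂μ).toReal := by
    intro t a
    rw [hin]
    have := integral_indicator_one (μ := μ) (hset t a)
    rw [Measure.real] at this
    rw [← this]
    refine integral_congr_ae (Eventually.of_forall fun ω => ?_)
    simp [indicator_apply]
  have h3 : Measurable (fun z : (ℝ × ℝ) × Ω => (if z.1.2 < V z.1.1 z.2 then (1 : ENNReal) else 0)) := by
    refine Measurable.ite ?_ measurable_const measurable_const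
    refine measurableSet_lt (by fun_prop) ?_
    exact hV.comp (g := fun z : ℝ × Ω => V z.1 z.2) (f := fun z : (ℝ × ℝ) × Ω => (z.1.1, z.2)) (by fun_prop)
  have h2 : Measurable (fun z : ℝ × ℝ => ∫⁻ ω, (if z.2 < V z.1 ω then (1 : ENNReal) else 0) ∂μ) :=
    Measurable.lintegral_prod_right' h3
  have hJm : Measurable J := Measurable.lintegral_prod_right' h2
  have hHJ : ∀ t, ∫ a in Ioi (0 : ℝ), ∫ ω, (if a < V t ω then (1 : ℝ) else 0) ∂μ = (J t).toReal := by
    intro t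
    simp only [hre]
    rw [integral_toReal]
    · exact (h2.comp (g := fun z : ℝ × ℝ => ∫⁻ ω, (if z.2 < V z.1 ω then (1 : ENNReal) else 0) ∂μ)
        (f := fun a : ℝ => (t, a)) (by fun_prop)).aemeasurable
    · refine Eventually.of_forall fun a => ?_
      simp only [hin]
      exact measure_lt_top _ _
  have hJ : ∫⁻ t, J t ∂ν = ENNReal.ofReal (1 / φ) := by
    rw [show ∫⁻ t, J t ∂ν = _ from tonelli hV ν]
    have e1 : ∫⁻ a in Ioi (0 : ℝ), ∫⁻ ω, ν {t | a < V t ω} ∂μ = ∫⁻ a in Ioi (0 : ℝ), ENNReal.ofReal (Real.exp (-φ * a)) := by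
      refine setLIntegral_congr_fun measurableSet_Ioi fun a ha => ?_
      have ha : 0 < a := ha
      have ht := hY.tail_q hφ.le hq hm hm2 ha
      rw [← ht.2, ofReal_integral_eq_lintegral_ofReal]
      · refine lintegral_congr_ae ?_
        filter_upwards [hY.good] with ω hω
        have := path_law hν hω ha
        simp only [hVd'] at this
        exact this
      · by_contra hcon
        have := integral_undef hcon
        rw [ht.2] at this
        exact (Real.exp_pos _).ne' this
      · refine Eventually.of_forall fun ω => ?_
        simp only [Pi.zero_apply]
        split_ifs <;> positivity
    rw [e1, ← integral_exp_Ioi hφ, ofReal_integral_eq_lintegral_ofReal]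
    · exact exp_neg_integrableOn_Ioi 0 hφ
    · exact Eventually.of_forall fun a => (Real.exp_pos _).le
  simp only [hHJ]
  refine ⟨integrable_toReal_of_lintegral_ne_top hJm.aemeasurable (by rw [hJ]; exact ENNReal.ofReal_ne_top), ?_⟩
  rw [integral_toReal hJm.aemeasurable (ae_lt_top hJm (by rw [hJ]; exact ENNReal.ofReal_ne_top)), hJ,
    ENNReal.toReal_ofReal (by positivity)]

lemma meas_path (hY : LP μ Y) : Measurable (fun ω => fun t : ℝ => Y t ω) :=
  measurable_pi_lambda _ hY.meas

lemma meas_negUU (t : ℝ) : Measurable (fun f : ℝ → ℝ => UU t (fun s => - f s)) :=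
  meas_UU_fix (Y := fun s (f : ℝ → ℝ) => - f s) (fun s => (measurable_pi_apply s).neg) t

lemma fixed_t (hY : LP μ Y) [IsProbabilityMeasure μ] {p x : ℝ} (hp : 0 < p) (hx : 0 < x) {Q : Ω → ℝ} (hQ : Measurable Q)
    (hT : ∀ u, 0 < u → ∫ ω, (if u < Q ω then (1 : ℝ) else 0) ∂μ = Real.exp (-p * u))
    (hQi : IndepFun Q (fun ω => fun t : ℝ => Y t ω) μ) {t : ℝ} (ht : 0 < t) :
    ∫ ω, Real.exp (-x * max 0 (Q ω - UU t (fun s => - Y s ω))) ∂μ =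
    1 - x / (x + p) * ∫ ω, Real.exp (-p * UU t (fun s => - Y s ω)) ∂μ := by
  obtain ⟨R, hRd⟩ : ∃ R : (ℝ → ℝ) → ℝ, R = fun f => UU t (fun s => - f s) := ⟨_, rfl⟩
  have hR : Measurable R := by rw [hRd]; exact meas_negUU t
  have hRd' : ∀ ω, UU t (fun s => - Y s ω) = R (fun s => Y s ω) := fun ω => by rw [hRd]
  simp only [hRd']
  let G : (ℝ → ℝ) × ℝ → ℝ := fun z => Real.exp (-x * max 0 (z.2 - R z.1))
  have hG : Measurable G := by
    have : Measurable (fun z : (ℝ → ℝ) × ℝ => R z.1) := hR.comp measurable_fst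
    fun_prop
  have hb : ∀ z, ‖G z‖ ≤ 1 := by
    intro z
    rw [Real.norm_of_nonneg (Real.exp_pos _).le, Real.exp_le_one_iff]
    have := le_max_left 0 (z.2 - R z.1)
    nlinarith
  have h1 := indep_integral hY.meas_path hQ hQi.symm hG hb
  simp only [G] at h1
  rw [h1]
  have := Measure.isProbabilityMeasure_map (μ := μ) hY.meas_path.aemeasurable
  have hpos : ∀ᵐ f ∂(μ.map (fun ω => fun t : ℝ => Y t ω)), 0 ≤ R f := by
    rw [ae_map_iff hY.meas_path.aemeasurable (measurableSet_le measurable_const hR)]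
    filter_upwards [hY.good] with ω hω
    rw [hRd]
    have := (hω.1.neg.isLUB ht.le).1 ⟨0, ⟨le_rfl, ht.le⟩, rfl⟩
    simpa [hY.zero] using this
  have h2 : ∫ f, (∫ ω, Real.exp (-x * max 0 (Q ω - R f)) ∂μ) ∂(μ.map (fun ω => fun t : ℝ => Y t ω))
      = ∫ f, (1 - x / (x + p) * Real.exp (-p * R f)) ∂(μ.map (fun ω => fun t : ℝ => Y t ω)) := by
    refine integral_congr_ae ?_
    filter_upwards [hpos] with f hf
    exact Q_shift hp hx hQ hT hf
  rw [h2]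
  have hi : Integrable (fun f => Real.exp (-p * R f)) (μ.map (fun ω => fun t : ℝ => Y t ω)) := by
    refine Integrable.of_bound (by fun_prop : Measurable _).aestronglyMeasurable 1 ?_
    filter_upwards [hpos] with f hf
    rw [Real.norm_of_nonneg (Real.exp_pos _).le, Real.exp_le_one_iff]
    nlinarith
  rw [integral_sub (integrable_const _) (hi.const_mul _), integral_const_mul]
  have h3 : ∫ f, Real.exp (-p * R f) ∂(μ.map (fun ω => fun t : ℝ => Y t ω)) = ∫ ω, Real.exp (-p * R (fun t => Y t ω)) ∂μ :=
    integral_map (f := fun f => Real.exp (-p * R f)) hY.meas_path.aemeasurable (by fun_prop : Measurable _).aestronglyMeasurable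
  rw [h3]
  simp

lemma core (hY : LP μ Y) [IsProbabilityMeasure μ] {p x q φ c2 c3 : ℝ} (hp : 0 < p) (hx : 0 < x) (hq : 0 < q) (hφ : 0 < φ)
    {Q e : Ω → ℝ} (hQ : Measurable Q) (he : Measurable e)
    (hT : ∀ u, 0 < u → ∫ ω, (if u < Q ω then (1 : ℝ) else 0) ∂μ = Real.exp (-p * u))
    (hQi : IndepFun Q (fun ω => fun t : ℝ => Y t ω) μ)
    (hei : IndepFun e (fun ω => (Q ω, fun t : ℝ => Y t ω)) μ)
    (hm : ∀ t, 0 ≤ t → lm μ Y φ t = ENNReal.ofReal (Real.exp (q * t)))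
    (hm2 : ∀ t, 0 ≤ t → lm μ Y (2 * φ) t = ENNReal.ofReal (Real.exp (c2 * t)))
    (hmp : ∀ t, 0 ≤ t → lm μ Y p t = ENNReal.ofReal (Real.exp (0 * t)))
    (hmp2 : ∀ t, 0 ≤ t → lm μ Y (2 * p) t = ENNReal.ofReal (Real.exp (c3 * t)))
    (hee : ∀ y : ℝ, 0 ≤ y → μ {ω | y < e ω} = ENNReal.ofReal (Real.exp (-(q * y)))) :
    ∫ ω, Real.exp (-x * max 0 (Q ω - UU (e ω) (fun s => - Y s ω))) ∂μ = (p / (x + p)) * ((φ + x) / φ) := by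
  have hνp := Measure.isProbabilityMeasure_map (μ := μ) he.aemeasurable
  have hν : ∀ y : ℝ, 0 ≤ y → (μ.map e) (Ioi y) = ENNReal.ofReal (Real.exp (-(q * y))) := by
    intro y hy
    rw [Measure.map_apply he measurableSet_Ioi, ← hee y hy]
    rfl
  obtain ⟨R, hRd⟩ : ∃ R : ℝ × (ℝ × (ℝ → ℝ)) → ℝ, R = fun z => UU z.1 (fun s => - z.2.2 s) := ⟨_, rfl⟩
  have hR : Measurable R := by
    rw [hRd]
    exact meas_UU_comp (Y := fun s (z : ℝ × (ℝ → ℝ)) => - z.2 s) (fun s => ((measurable_pi_apply s).comp measurable_snd).neg)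
  let G : ℝ × (ℝ × (ℝ → ℝ)) → ℝ := fun z => Real.exp (-x * max 0 (z.2.1 - R z))
  have hG : Measurable G := by fun_prop
  have hb : ∀ z, ‖G z‖ ≤ 1 := by
    intro z
    rw [Real.norm_of_nonneg (Real.exp_pos _).le, Real.exp_le_one_iff]
    have := le_max_left 0 (z.2.1 - R z)
    nlinarith
  have h1 := indep_integral he (hQ.prodMk hY.meas_path) hei hG hb
  simp only [G, hRd] at h1
  rw [h1]
  obtain ⟨hHi, hHv⟩ := hY.H_int hq hφ hm hm2 hν
  have hpos : ∀ᵐ t ∂(μ.map e), 0 < t := by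
    have h1 : (μ.map e) (Ioi 0) = 1 := by rw [hν 0 le_rfl]; simp
    exact (prob_compl_eq_zero_iff (μ := μ.map e) (measurableSet_Ioi (a := (0 : ℝ)))).2 h1
  have h2 : ∫ t, (∫ ω, Real.exp (-x * max 0 (Q ω - UU t (fun s => - Y s ω))) ∂μ) ∂(μ.map e)
      = ∫ t, ((1 - x / (x + p)) + (x / (x + p) * p) * (∫ a in Ioi (0 : ℝ), ∫ ω, (if a < UU t (fun s => Y s ω) then (1 : ℝ) else 0) ∂μ)) ∂(μ.map e) := by
    refine integral_congr_ae ?_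
    filter_upwards [hpos] with t ht
    rw [hY.fixed_t hp hx hQ hT hQi ht, hY.inf_formula hp hmp hmp2 ht]
    ring
  rw [h2, integral_add (integrable_const _) (hHi.const_mul _), integral_const_mul, hHv]
  simp
  field_simp
  ring

end LP

lemma iInf_UU {f : ℝ → ℝ} (hf : Cad f) {t : ℝ} (ht : 0 ≤ t) :
    ⨅ s : Set.Icc (0:ℝ) t, f (s : ℝ) = - UU t (fun s => - f s) := by
  have hl := hf.neg.isLUB ht
  have : Nonempty (Set.Icc (0:ℝ) t) := ⟨0, le_rfl, ht⟩
  refine IsGLB.ciInf_eq ⟨?_, ?_⟩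
  · rintro _ ⟨s, rfl⟩
    have := hl.1 ⟨s, s.2, rfl⟩
    simp only at this ⊢
    linarith
  · intro b hb
    have : UU t (fun s => - f s) ≤ -b := hl.2 (by
      rintro _ ⟨s, hs, rfl⟩
      have := hb ⟨⟨s, hs⟩, rfl⟩
      simp only at this ⊢
      linarith)
    linarith

/-- **Theorem 2.1** (spectrally negative case): double transform of `M(e_q)`. -/
theorem transform_inf_reflected_spectrally_negative
    {Ω : Type*} [MeasureSpace Ω] [IsProbabilityMeasure (ℙ : Measure Ω)]
    (X : ℝ → Ω → ℝ)
    (hmeas : ∀ t : ℝ, Measurable (X t))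
    (hX0 : ∀ᵐ ω ∂ℙ, X 0 ω = 0)
    (hpath : ∀ᵐ ω ∂ℙ, ∀ t : ℝ, 0 ≤ t →
      ContinuousWithinAt (fun s => X s ω) (Set.Ici t) t ∧
      (0 < t → ∃ l : ℝ, Tendsto (fun s => X s ω) (nhdsWithin t (Set.Iio t)) (nhds l)))
    (hstat : ∀ s t : ℝ, 0 ≤ s → s ≤ t →
      Measure.map (fun ω => X t ω - X s ω) ℙ = Measure.map (X (t - s)) ℙ)
    (hincr : ∀ (n : ℕ) (t : Fin (n + 1) → ℝ), (∀ i, 0 ≤ t i) → StrictMono t →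
      iIndepFun
        (fun i : Fin n => fun ω => X (t i.succ) ω - X (t i.castSucc) ω) ℙ)
    (hint : Integrable (X 1) ℙ)
    (hmean : ∫ ω, X 1 ω ∂ℙ = 0)
    (Qe : Ω → ℝ) (hQe_meas : Measurable Qe)
    (hQe_dist : Measure.map Qe ℙ
      = Measure.map (fun ω => ⨆ r : {r : ℝ // 0 ≤ r}, (X (r : ℝ) ω - (r : ℝ))) ℙ)
    (hQe_indep : IndepFun Qe (fun ω => fun t : ℝ => X t ω) ℙ)
    (hSN : ∀ᵐ ω ∂ℙ, ∀ t : ℝ, 0 < t → ∀ l : ℝ,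
      Tendsto (fun s => X s ω) (nhdsWithin t (Set.Iio t)) (nhds l) → X t ω ≤ l)
    (hND : ¬ (∀ᵐ ω ∂ℙ, ∀ s t : ℝ, 0 ≤ s → s ≤ t → X t ω ≤ X s ω))
    (ψ : ℝ → ℝ) (hψ : ∀ θ : ℝ, ψ θ = Real.log (∫ ω, Real.exp (θ * (X 1 ω - 1)) ∂ℙ))
    (hψ_fin : ∀ θ : ℝ, 0 ≤ θ → Integrable (fun ω => Real.exp (θ * (X 1 ω - 1))) ℙ)
    (Φ : ℝ → ℝ) (hΦ : ∀ q : ℝ, Φ q = sSup {θ : ℝ | 0 ≤ θ ∧ ψ θ = q})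
    (hΦ0 : 0 < Φ 0)
    (x q : ℝ) (hx : 0 < x) (hq : 0 < q)
    (e : Ω → ℝ) (he_meas : Measurable e)
    (he_exp : ∀ y : ℝ, 0 ≤ y → ℙ {ω | y < e ω} = ENNReal.ofReal (Real.exp (-(q * y))))
    (he_indep : IndepFun e (fun ω => (Qe ω, fun t : ℝ => X t ω)) ℙ) :
    ∫ ω, Real.exp (-x * max 0
        (Qe ω + ⨅ s : Set.Icc (0:ℝ) (e ω), (X (s : ℝ) ω - (s : ℝ)))) ∂ℙ
      = (Φ 0 / (x + Φ 0)) * ((Φ q + x) / Φ q) := by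
  have hgoodX : ∀ᵐ ω ∂ℙ, Good (fun t => X t ω - X 0 ω - t) := by
    filter_upwards [hpath, hSN] with ω h1 h2
    refine ⟨fun t ht => ?_, by simp, fun t ht l hl => ?_⟩
    · obtain ⟨ha, hb⟩ := h1 t ht
      refine ⟨(ha.sub continuousWithinAt_const).sub continuousWithinAt_id, fun h0 => ?_⟩
      obtain ⟨l, hl⟩ := hb h0
      exact ⟨l - X 0 ω - t, (hl.sub tendsto_const_nhds).sub (tendsto_id.mono_left nhdsWithin_le_nhds)⟩
    · have h3 : Tendsto (fun s => X s ω) (nhdsWithin t (Set.Iio t)) (nhds (l + t + X 0 ω)) := by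
        have := (hl.add (tendsto_id.mono_left (nhdsWithin_le_nhds (a := t) (s := Set.Iio t)))).add
          (tendsto_const_nhds (x := X 0 ω))
        refine this.congr fun s => ?_
        simp only [id]
        ring
      have := h2 t ht _ h3
      linarith
  have hY : LP (ℙ : Measure Ω) (fun t ω => X t ω - X 0 ω - t) := by
    refine ⟨fun t => ((hmeas t).sub (hmeas 0)).sub measurable_const, fun ω => by simp, hgoodX, ?_, ?_⟩
    · intro s t hs hst
      have hg : Measurable (fun z : ℝ => z - (t - s)) := by fun_prop
      have e1 : Measure.map (fun ω => X t ω - X 0 ω - t - (X s ω - X 0 ω - s)) ℙ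
          = Measure.map (fun z : ℝ => z - (t - s)) (Measure.map (fun ω => X t ω - X s ω) ℙ) := by
        rw [Measure.map_map hg (show Measurable (fun ω => X t ω - X s ω) from (hmeas t).sub (hmeas s))]
        congr 1; ext ω; simp only [Function.comp]; ring
      have e2 : Measure.map (fun ω => X (t - s) ω - X 0 ω - (t - s)) ℙ
          = Measure.map (fun z : ℝ => z - (t - s)) (Measure.map (X (t - s)) ℙ) := by
        rw [Measure.map_map hg (hmeas _)]
        refine Measure.map_congr ?_
        filter_upwards [hX0] with ω h
        simp only [Function.comp, h]; ring
      exact e1.trans ((congrArg _ (hstat s t hs hst)).trans e2.symm)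
    · intro n t h0 ht
      have := (hincr n t h0 ht).comp (fun i (z : ℝ) => z - (t i.succ - t i.castSucc)) (fun i => by fun_prop)
      refine this.congr fun i => Eventually.of_forall fun ω => ?_
      simp only [Function.comp]; ring
  have hpos : ∀ θ : ℝ, 0 ≤ θ → 0 < ∫ ω, Real.exp (θ * (X 1 ω - 1)) ∂ℙ := fun θ hθ => integral_exp_pos (hψ_fin θ hθ)
  obtain ⟨hψp, hψq, hlim⟩ := phi_facts (m := fun θ => ∫ ω, Real.exp (θ * (X 1 ω - 1)) ∂ℙ) (mgf_convex hψ_fin)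
    (by simp) hpos hψ hΦ hΦ0
  have hlm : ∀ θ : ℝ, 0 ≤ θ → ∀ t, 0 ≤ t →
      LP.lm (ℙ : Measure Ω) (fun t ω => X t ω - X 0 ω - t) θ t = ENNReal.ofReal (Real.exp (ψ θ * t)) := by
    intro θ hθ t ht
    refine hY.lm_eq ?_ ht
    rw [hψ, Real.exp_log (hpos θ hθ), ofReal_integral_eq_lintegral_ofReal (hψ_fin θ hθ)
      (Eventually.of_forall fun ω => (Real.exp_pos _).le)]
    refine lintegral_congr_ae ?_
    filter_upwards [hX0] with ω h
    simp only [h, sub_zero]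
  have hn : ∀ n : ℕ, (0 : ℝ) < 1 / ((n : ℝ) + 1) := fun n => by positivity
  have hΦn : ∀ n : ℕ, 0 ≤ Φ (1 / ((n : ℝ) + 1)) := fun n => (hΦ0.trans (hψq _ (hn n)).1).le
  obtain ⟨hpq, hψΦ⟩ := hψq q hq
  have hφ : 0 < Φ q := hΦ0.trans hpq
  classical
  have hA : ∀ a, 0 < a → ∫ ω, (if ∃ s, 0 ≤ s ∧ a < X s ω - X 0 ω - s then (1 : ℝ) else 0) ∂ℙ = Real.exp (-Φ 0 * a) := by
    intro a ha
    have := hY.tail_0 (p := Φ 0) (θ := fun n : ℕ => Φ (1 / ((n : ℝ) + 1))) (c := fun n : ℕ => 1 / ((n : ℝ) + 1))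
      (c2 := fun n : ℕ => ψ (2 * Φ (1 / ((n : ℝ) + 1)))) hΦn hn
      (fun n t ht => by
        have := hlm _ (hΦn n) t ht
        rwa [(hψq _ (hn n)).2] at this)
      (fun n t ht => hlm _ (by have := hΦn n; positivity) t ht) hlim tendsto_one_div_add_atTop_nhds_zero_nat ha
    convert this using 4
  have hd : Measure.map Qe ℙ = Measure.map (fun ω => ⨆ r : {r : ℝ // 0 ≤ r}, (X (r : ℝ) ω - X 0 ω - (r : ℝ))) ℙ := by
    rw [hQe_dist]
    refine Measure.map_congr ?_
    filter_upwards [hX0] with ω h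
    simp only [h, sub_zero]
  have hT : ∀ u, 0 < u → ∫ ω, (if u < Qe ω then (1 : ℝ) else 0) ∂ℙ = Real.exp (-Φ 0 * u) := by
    intro u hu
    refine hY.Q_tail hΦ0 ?_ hQe_meas hd hu
    intro a ha
    convert hA a ha using 4
  have hgm : Measurable (fun f : ℝ → ℝ => fun t : ℝ => f t - f 0 - t) :=
    measurable_pi_lambda _ fun t => ((measurable_pi_apply t).sub (measurable_pi_apply 0)).sub measurable_const
  have hQi : IndepFun Qe (fun ω => fun t : ℝ => X t ω - X 0 ω - t) ℙ :=
    hQe_indep.comp (φ := id) (ψ := fun f : ℝ → ℝ => fun t : ℝ => f t - f 0 - t) measurable_id hgm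
  have hei : IndepFun e (fun ω => (Qe ω, fun t : ℝ => X t ω - X 0 ω - t)) ℙ :=
    he_indep.comp (φ := id) (ψ := fun z : ℝ × (ℝ → ℝ) => (z.1, fun t : ℝ => z.2 t - z.2 0 - t)) measurable_id
      (measurable_fst.prodMk (hgm.comp measurable_snd))
  have hcore := hY.core (c2 := ψ (2 * Φ q)) (c3 := ψ (2 * Φ 0)) hΦ0 hx hq hφ hQe_meas he_meas hT hQi hei
    (fun t ht => by
      have := hlm _ hφ.le t ht
      rwa [hψΦ] at this)
    (fun t ht => hlm _ (by positivity) t ht)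
    (fun t ht => by
      have := hlm _ hΦ0.le t ht
      rwa [hψp] at this)
    (fun t ht => hlm _ (by positivity) t ht) he_exp
  rw [← hcore]
  refine integral_congr_ae ?_
  have hepos : ∀ᵐ ω ∂ℙ, 0 < e ω := by
    have h1 : (ℙ : Measure Ω) {ω | 0 < e ω} = 1 := by rw [he_exp 0 le_rfl]; simp
    exact (prob_compl_eq_zero_iff (measurableSet_lt measurable_const he_meas)).2 h1
  filter_upwards [hgoodX, hepos, hX0] with ω h1 h2 h3
  have := iInf_UU h1.1 h2.le
  simp only [h3, sub_zero] at this ⊢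
  rw [this, sub_eq_add_neg]
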